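/- arXiv:1905.10963 — 13 statements merged into one kernel-verified Lean document; each statement's English description precedes it below -/
import Mathlib

section
/- Let d ≥ 1, let K be a positive definite d×d real matrix, let v ∈ ℝ^d, and let J be a symmetric positive semidefinite d×d real matrix. Then the expectation of the function x ↦ exp(-(1/2) xᵀ J x) with respect to the multivariate Gaussian measure with mean v and covariance K on ℝ^d equals exp(-(1/2) vᵀ A v) / sqrt(det(I + K J)), where A = K⁻¹ (I - (I + K J)⁻¹). (Lemma 2 of the paper.) -/
open MeasureTheory Matrix

/-- The multivariate Gaussian measure on `ℝ^d` with mean `v` and covariance matrix `K`,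
defined via its density with respect to Lebesgue measure. -/
noncomputable def multivariateGaussian {d : ℕ} (v : Fin d → ℝ) (K : Matrix (Fin d) (Fin d) ℝ) :
    Measure (Fin d → ℝ) :=
  volume.withDensity fun x =>
    ENNReal.ofReal (Real.exp (-(1/2) * ((x - v) ⬝ᵥ (K⁻¹ *ᵥ (x - v)))) /
      Real.sqrt ((2 * Real.pi) ^ d * K.det))

open scoped MatrixOrder in
theorem Matrix.PosDef.exists_isUnit_eq_transpose_mul_self {ι : Type*} [Fintype ι] [DecidableEq ι]
    {M : Matrix ι ι ℝ} (hM : M.PosDef) : ∃ B : Matrix ι ι ℝ, IsUnit B ∧ M = Bᵀ * B := by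
  obtain ⟨B, hB, h⟩ := CStarAlgebra.isStrictlyPositive_iff_eq_star_mul_self.1
    (isStrictlyPositive_iff_posDef.2 hM)
  exact ⟨B, hB, by rw [h, star_eq_conjTranspose, conjTranspose_eq_transpose_of_trivial]⟩

theorem Matrix.IsSymm.dotProduct_mulVec_comm {ι R : Type*} [Fintype ι] [CommSemiring R]
    {S : Matrix ι ι R} (hS : S.IsSymm) (x y : ι → R) : x ⬝ᵥ (S *ᵥ y) = y ⬝ᵥ (S *ᵥ x) := by
  rw [← dotProduct_transpose_mulVec, hS.eq]

theorem integral_exp_neg_half_dotProduct_self {ι : Type*} [Fintype ι] :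
    ∫ x : ι → ℝ, Real.exp (-(1/2) * (x ⬝ᵥ x)) = Real.sqrt ((2 * Real.pi) ^ Fintype.card ι) := by
  have h (x : ι → ℝ) :
      Real.exp (-(1/2) * (x ⬝ᵥ x)) = ∏ i, Real.exp (-(1/2) * x i ^ 2) := by
    rw [← Real.exp_sum, dotProduct, Finset.mul_sum]
    simp only [sq]
  simp_rw [h]
  rw [integral_fintype_prod_volume_eq_pow (fun t : ℝ ↦ Real.exp (-(1/2) * t ^ 2)),
    integral_gaussian, eq_comm, Real.sqrt_eq_iff_mul_self_eq (by positivity) (by positivity),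
    ← mul_pow, Real.mul_self_sqrt (by positivity)]
  congr 1
  ring

theorem integral_comp_mulVec {ι E : Type*} [Fintype ι] [DecidableEq ι] [NormedAddCommGroup E]
    [NormedSpace ℝ E] {B : Matrix ι ι ℝ} (hB : B.det ≠ 0) (g : (ι → ℝ) → E) :
    ∫ x, g (B *ᵥ x) = |B.det|⁻¹ • ∫ x, g x := by
  have hinj : Function.Injective (toLin' B) :=
    mulVec_injective_iff_isUnit.2 ((isUnit_iff_isUnit_det B).2 hB.isUnit)
  have hemb : MeasurableEmbedding (toLin' B) :=
    (LinearMap.isClosedEmbedding_of_injective (LinearMap.ker_eq_bot.2 hinj)).measurableEmbedding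
  have h := hemb.integral_map (μ := volume) g
  simp only [toLin'_apply] at h
  rw [← h, Real.map_matrix_volume_pi_eq_smul_volume_pi hB, integral_smul_measure,
    ENNReal.toReal_ofReal (abs_nonneg _), abs_inv]

theorem Matrix.PosDef.integral_exp_neg_half_quadratic {ι : Type*} [Fintype ι] [DecidableEq ι]
    {M : Matrix ι ι ℝ} (hM : M.PosDef) :
    ∫ x, Real.exp (-(1/2) * (x ⬝ᵥ (M *ᵥ x))) =
      Real.sqrt ((2 * Real.pi) ^ Fintype.card ι) / Real.sqrt M.det := by
  obtain ⟨B, hB, rfl⟩ := hM.exists_isUnit_eq_transpose_mul_self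
  have h (x : ι → ℝ) : x ⬝ᵥ ((Bᵀ * B) *ᵥ x) = (B *ᵥ x) ⬝ᵥ (B *ᵥ x) := by
    rw [← mulVec_mulVec, dotProduct_transpose_mulVec]
  simp_rw [h]
  rw [integral_comp_mulVec ((isUnit_iff_isUnit_det B).1 hB).ne_zero
      (fun y ↦ Real.exp (-(1/2) * (y ⬝ᵥ y))), integral_exp_neg_half_dotProduct_self, det_mul,
    det_transpose, Real.sqrt_mul_self_eq_abs, smul_eq_mul, div_eq_inv_mul]

/-- Lemma 2: expectation of an exponential quadratic form under a multivariate Gaussian. -/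
theorem expectation_exp_quadratic (d : ℕ) (hd : 1 ≤ d)
    (K : Matrix (Fin d) (Fin d) ℝ) (hK : K.PosDef)
    (v : Fin d → ℝ) (J : Matrix (Fin d) (Fin d) ℝ) (hJ : J.PosSemidef) :
    (∫ x, Real.exp (-(1/2) * (x ⬝ᵥ (J *ᵥ x))) ∂(multivariateGaussian v K)) =
      Real.exp (-(1/2) * (v ⬝ᵥ ((K⁻¹ * (1 - (1 + K * J)⁻¹)) *ᵥ v))) /
        Real.sqrt (1 + K * J).det := by
  have hM : (K⁻¹ + J).PosDef := hK.inv.add_posSemidef hJ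
  have hKM : 1 + K * J = K * (K⁻¹ + J) := by
    rw [mul_add, mul_nonsing_inv _ hK.det_pos.ne'.isUnit]
  have hMS : (K⁻¹ + J).IsSymm :=
    (conjTranspose_eq_transpose_of_trivial _).symm.trans hM.isHermitian
  have hKS : (K⁻¹).IsSymm :=
    (conjTranspose_eq_transpose_of_trivial _).symm.trans hK.inv.isHermitian
  set c : Fin d → ℝ := (1 + K * J)⁻¹ *ᵥ v with hc
  have hMc : (K⁻¹ + J) *ᵥ c = K⁻¹ *ᵥ v := by
    rw [hc, hKM, Matrix.mul_inv_rev, ← mulVec_mulVec, mulVec_mulVec,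
      mul_nonsing_inv _ hM.det_pos.ne'.isUnit, one_mulVec]
  have hA : v ⬝ᵥ ((K⁻¹ * (1 - (1 + K * J)⁻¹)) *ᵥ v) =
      v ⬝ᵥ (K⁻¹ *ᵥ v) - v ⬝ᵥ (K⁻¹ *ᵥ c) := by
    rw [← mulVec_mulVec, sub_mulVec, one_mulVec, mulVec_sub, dotProduct_sub]
  have hsq (x : Fin d → ℝ) :
      (x - v) ⬝ᵥ (K⁻¹ *ᵥ (x - v)) + x ⬝ᵥ (J *ᵥ x) =
        v ⬝ᵥ ((K⁻¹ * (1 - (1 + K * J)⁻¹)) *ᵥ v) + (x - c) ⬝ᵥ ((K⁻¹ + J) *ᵥ (x - c)) := by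
    have h1 : c ⬝ᵥ ((K⁻¹ + J) *ᵥ x) = x ⬝ᵥ (K⁻¹ *ᵥ v) := by
      rw [hMS.dotProduct_mulVec_comm, hMc]
    rw [hA, mulVec_sub _ x c, hMc, mulVec_sub]
    simp only [sub_dotProduct, dotProduct_sub]
    rw [h1, add_mulVec, dotProduct_add, hKS.dotProduct_mulVec_comm c v,
      hKS.dotProduct_mulVec_comm v x]
    ring
  have hmeas : Measurable fun x : Fin d → ℝ ↦
      ENNReal.ofReal (Real.exp (-(1/2) * ((x - v) ⬝ᵥ (K⁻¹ *ᵥ (x - v)))) /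
        Real.sqrt ((2 * Real.pi) ^ d * K.det)) := by
    refine (Continuous.measurable ?_).ennreal_ofReal
    fun_prop
  have hint (x : Fin d → ℝ) :
      (ENNReal.ofReal (Real.exp (-(1/2) * ((x - v) ⬝ᵥ (K⁻¹ *ᵥ (x - v)))) /
        Real.sqrt ((2 * Real.pi) ^ d * K.det))).toReal • Real.exp (-(1/2) * (x ⬝ᵥ (J *ᵥ x))) =
      Real.exp (-(1/2) * (v ⬝ᵥ ((K⁻¹ * (1 - (1 + K * J)⁻¹)) *ᵥ v))) /
        Real.sqrt ((2 * Real.pi) ^ d * K.det) *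
        Real.exp (-(1/2) * ((x - c) ⬝ᵥ ((K⁻¹ + J) *ᵥ (x - c)))) := by
    rw [ENNReal.toReal_ofReal (by positivity), smul_eq_mul, div_mul_eq_mul_div,
      div_mul_eq_mul_div, ← Real.exp_add, ← Real.exp_add, ← mul_add, ← mul_add, hsq]
  rw [multivariateGaussian, integral_withDensity_eq_integral_toReal_smul hmeas
    (ae_of_all _ fun _ ↦ ENNReal.ofReal_lt_top)]
  simp_rw [hint]
  rw [integral_const_mul, integral_sub_right_eq_self
    (fun x ↦ Real.exp (-(1/2) * (x ⬝ᵥ ((K⁻¹ + J) *ᵥ x)))) c,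
    hM.integral_exp_neg_half_quadratic, Fintype.card_fin, hKM, det_mul,
    Real.sqrt_mul (by positivity), Real.sqrt_mul hK.det_pos.le]
  have h1 := Real.sqrt_pos.2 hK.det_pos
  have h2 := Real.sqrt_pos.2 hM.det_pos
  have h3 : 0 < Real.sqrt ((2 * Real.pi) ^ d) := by positivity
  field_simp
end

section
/- Let (h_i, h_j) be a centered bivariate Gaussian vector on ℝ² with positive definite covariance matrix [[k_ii, k_ij], [k_ij, k_jj]], and let σ > 0, ℓ > 0. Then E[σ² exp(-(h_i - h_j)² / (2ℓ²))] = σ² (1 + (k_ii + k_jj - 2 k_ij)/ℓ²)^{-1/2}. (The second moment of the two-layer DGP SE[·], Eq. (14) of the paper.) -/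
open MeasureTheory Matrix

/-- A positive definite binary quadratic form dominates a multiple of `x ^ 2 + y ^ 2`. -/
lemma binary_quadratic_lower_bound {a b c : ℝ} (ha : 0 < a) (hc : 0 < c) (x y : ℝ) :
    (a * c - b ^ 2) / (a + c) * (x ^ 2 + y ^ 2) ≤ a * x ^ 2 + 2 * b * x * y + c * y ^ 2 := by
  rw [div_mul_eq_mul_div, div_le_iff₀ (by positivity)]
  nlinarith [sq_nonneg (a * x + b * y), sq_nonneg (b * x + c * y)]

lemma integrable_exp_neg_binary_quadratic {a b c : ℝ} (ha : 0 < a) (hc : 0 < c)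
    (hD : 0 < a * c - b ^ 2) :
    Integrable fun p : ℝ × ℝ =>
      Real.exp (-(1 / 2) * (a * p.1 ^ 2 + 2 * b * p.1 * p.2 + c * p.2 ^ 2)) := by
  have hm : 0 < (a * c - b ^ 2) / (a + c) / 2 := by positivity
  have hg := integrable_exp_neg_mul_sq hm
  refine (hg.mul_prod hg).mono' (by fun_prop) (Filter.Eventually.of_forall fun p => ?_)
  rw [Real.norm_eq_abs, Real.abs_exp, ← Real.exp_add, Real.exp_le_exp]
  linarith [binary_quadratic_lower_bound (b := b) ha hc p.1 p.2]

/-- The Gaussian integral of a positive definite binary quadratic form. -/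
lemma integral_exp_neg_binary_quadratic {a b c : ℝ} (ha : 0 < a) (hc : 0 < c)
    (hD : 0 < a * c - b ^ 2) :
    ∫ p : ℝ × ℝ, Real.exp (-(1 / 2) * (a * p.1 ^ 2 + 2 * b * p.1 * p.2 + c * p.2 ^ 2)) =
      2 * Real.pi / Real.sqrt (a * c - b ^ 2) := by
  have hi := integrable_exp_neg_binary_quadratic ha hc hD
  rw [Measure.volume_eq_prod] at hi ⊢
  rw [integral_prod _ hi]
  have inner (x : ℝ) :
      ∫ y, Real.exp (-(1 / 2) * (a * x ^ 2 + 2 * b * x * y + c * y ^ 2)) =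
        Real.exp (-((a * c - b ^ 2) / c / 2) * x ^ 2) * Real.sqrt (Real.pi / (c / 2)) := by
    rw [← integral_gaussian, ← integral_const_mul,
      ← integral_add_right_eq_self
        (fun y => Real.exp (-((a * c - b ^ 2) / c / 2) * x ^ 2) * Real.exp (-(c / 2) * y ^ 2))
        (b * x / c)]
    congr 1 with y
    rw [← Real.exp_add]
    congr 1
    field_simp
    ring
  simp_rw [inner]
  rw [integral_mul_const, integral_gaussian, ← Real.sqrt_mul (by positivity)]
  have h : Real.pi / ((a * c - b ^ 2) / c / 2) * (Real.pi / (c / 2)) =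
      (2 * Real.pi) ^ 2 / (a * c - b ^ 2) := by
    field_simp
  rw [h, Real.sqrt_div (by positivity), Real.sqrt_sq (by positivity)]

/-- Integration against `multivariateGaussian` is weighted Lebesgue integration. -/
lemma integral_multivariateGaussian {d : ℕ} (v : Fin d → ℝ) (K : Matrix (Fin d) (Fin d) ℝ)
    (f : (Fin d → ℝ) → ℝ) :
    ∫ x, f x ∂(multivariateGaussian v K) =
      ∫ x, Real.exp (-(1/2) * ((x - v) ⬝ᵥ (K⁻¹ *ᵥ (x - v)))) /
        Real.sqrt ((2 * Real.pi) ^ d * K.det) * f x := by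
  unfold multivariateGaussian
  rw [integral_withDensity_eq_integral_toReal_smul]
  · congr 1 with x
    rw [ENNReal.toReal_ofReal (by positivity), smul_eq_mul]
  · refine Measurable.ennreal_ofReal (Continuous.measurable ?_)
    refine Continuous.div_const (Real.continuous_exp.comp (continuous_const.mul ?_)) _
    have hx : Continuous fun x : Fin d → ℝ => x - v := by fun_prop
    exact hx.dotProduct (continuous_const.matrix_mulVec hx)
  · exact Filter.Eventually.of_forall fun x => ENNReal.ofReal_lt_top

lemma inv_two_dotProduct_mulVec (p q r : ℝ) (x : Fin 2 → ℝ) :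
    x ⬝ᵥ ((!![p, q; q, r])⁻¹ *ᵥ x) =
      (r * x 0 ^ 2 - 2 * q * x 0 * x 1 + p * x 1 ^ 2) / (p * r - q ^ 2) := by
  rw [Matrix.inv_def, Matrix.adjugate_fin_two_of, Matrix.det_fin_two_of, Ring.inverse_eq_inv',
    Matrix.smul_mulVec, dotProduct_smul]
  simp [Matrix.mulVec, dotProduct, Fin.sum_univ_two]
  ring

/-- Second moment of the two-layer DGP SE[·], Eq. (14). -/
theorem second_moment_SE (kii kij kjj σ ℓ : ℝ) (hσ : 0 < σ) (hℓ : 0 < ℓ)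
    (hK : (!![kii, kij; kij, kjj]).PosDef) :
    (∫ h, σ^2 * Real.exp (-(h 0 - h 1)^2 / (2 * ℓ^2))
        ∂(multivariateGaussian 0 !![kii, kij; kij, kjj])) =
      σ^2 * (1 + (kii + kjj - 2 * kij) / ℓ^2) ^ (-(1:ℝ)/2) := by
  have hii : 0 < kii := by simpa using hK.diag_pos (i := 0)
  have hjj : 0 < kjj := by simpa using hK.diag_pos (i := 1)
  have hdet : (!![kii, kij; kij, kjj]).det = kii * kjj - kij ^ 2 := by
    rw [Matrix.det_fin_two_of]; ring
  have hΔ : 0 < kii * kjj - kij ^ 2 := hdet ▸ hK.det_pos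
  have hvar : 0 < kii + kjj - 2 * kij := by
    refine pos_of_mul_pos_right (a := kii) ?_ hii.le
    nlinarith [sq_nonneg (kii - kij)]
  rw [integral_multivariateGaussian, hdet]
  set Δ := kii * kjj - kij ^ 2 with hΔ_def
  set S := 1 + (kii + kjj - 2 * kij) / ℓ ^ 2 with hS_def
  have hS : 0 < S := by positivity
  have hD : (kjj / Δ + 1 / ℓ ^ 2) * (kii / Δ + 1 / ℓ ^ 2) - (-kij / Δ - 1 / ℓ ^ 2) ^ 2 =
      S / Δ := by
    have hprod : kii * kjj = Δ + kij ^ 2 := by rw [hΔ_def]; ring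
    rw [hS_def]
    field_simp
    linear_combination ℓ ^ 4 * hprod
  have hint := integral_exp_neg_binary_quadratic (a := kjj / Δ + 1 / ℓ ^ 2)
    (b := -kij / Δ - 1 / ℓ ^ 2) (c := kii / Δ + 1 / ℓ ^ 2) (by positivity) (by positivity)
    (by rw [hD]; positivity)
  rw [hD, ← (volume_preserving_finTwoArrow ℝ).integral_comp'] at hint
  calc
    _ = ∫ x : Fin 2 → ℝ, σ ^ 2 / Real.sqrt ((2 * Real.pi) ^ 2 * Δ) *
        Real.exp (-(1 / 2) * ((kjj / Δ + 1 / ℓ ^ 2) * x 0 ^ 2 +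
          2 * (-kij / Δ - 1 / ℓ ^ 2) * x 0 * x 1 + (kii / Δ + 1 / ℓ ^ 2) * x 1 ^ 2)) := by
      congr 1 with x
      rw [sub_zero, inv_two_dotProduct_mulVec, ← hΔ_def, div_mul_eq_mul_div, mul_left_comm,
        ← Real.exp_add, mul_div_right_comm]
      congr 2
      field_simp
      ring
    _ = σ ^ 2 / Real.sqrt ((2 * Real.pi) ^ 2 * Δ) * (2 * Real.pi / Real.sqrt (S / Δ)) := by
      rw [integral_const_mul, ← hint]
      rfl
    _ = σ ^ 2 * S ^ (-(1 : ℝ) / 2) := by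
      rw [neg_div, Real.rpow_neg hS.le, ← Real.sqrt_eq_rpow, Real.sqrt_mul (by positivity),
        Real.sqrt_sq (by positivity), Real.sqrt_div hS.le]
      have := Real.sqrt_pos.2 hΔ
      have := Real.sqrt_pos.2 hS
      field_simp
end

section
/- Let (h_i, h_j) be a centered bivariate Gaussian vector on ℝ² with positive definite covariance matrix [[k_ii, k_ij], [k_ij, k_jj]], and let σ > 0, ℓ > 0. Then E[σ² cos²((h_i - h_j)/(2ℓ))] = (σ²/2) [1 + exp((2 k_ij - k_ii - k_jj)/(2ℓ²))]. (The second moment of the two-layer DGP SC[·], Eq. (17) of the paper.) -/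
open MeasureTheory Matrix

open ProbabilityTheory in
theorem integral_cos_mul_gaussianReal (t : ℝ) :
    ∫ x, Real.cos (t * x) ∂(gaussianReal 0 1) = Real.exp (-t ^ 2 / 2) := by
  have h := charFun_gaussianReal (μ := 0) (v := 1) t
  rw [charFun_apply_real] at h
  have h' := congrArg Complex.re h
  have hint : Integrable (fun x : ℝ => Complex.exp (t * x * Complex.I)) (gaussianReal 0 1) := by
    refine (integrable_const (1 : ℝ)).mono' (by fun_prop) (ae_of_all _ fun x => ?_)
    rw [← Complex.ofReal_mul, Complex.norm_exp_ofReal_mul_I]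
  have hre := integral_re hint
  simp only [RCLike.re_eq_complex_re] at hre
  rw [← hre] at h'
  have hc (x : ℝ) : (Complex.exp (t * x * Complex.I)).re = Real.cos (t * x) := by
    rw [← Complex.ofReal_mul, Complex.exp_ofReal_mul_I_re]
  simp only [hc] at h'
  rw [h']
  have : (t * (0 : ℝ) * Complex.I - ((1 : NNReal) : ℝ) * t ^ 2 / 2 : ℂ)
      = ((-t ^ 2 / 2 : ℝ) : ℂ) := by
    push_cast
    ring
  rw [this, Complex.exp_ofReal_re]

open ProbabilityTheory in
theorem integral_cos_sq_gaussianReal (σ t : ℝ) :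
    ∫ x, σ ^ 2 * Real.cos (t * x) ^ 2 ∂(gaussianReal 0 1) =
      σ ^ 2 / 2 * (1 + Real.exp (-(2 * t) ^ 2 / 2)) := by
  have h (x : ℝ) : σ ^ 2 * Real.cos (t * x) ^ 2 =
      σ ^ 2 / 2 * (1 + Real.cos (2 * t * x)) := by
    rw [Real.cos_sq, mul_assoc 2 t x]
    ring
  have hint : Integrable (fun x : ℝ => Real.cos (2 * t * x)) (gaussianReal 0 1) :=
    (integrable_const (1 : ℝ)).mono' (by fun_prop)
      (ae_of_all _ fun x => by simpa using Real.abs_cos_le_one (2 * t * x))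
  simp only [h]
  rw [integral_const_mul, integral_add (integrable_const _) hint, integral_cos_mul_gaussianReal]
  simp

/-- Integration against a centered Gaussian density, in the coordinates `h = M *ᵥ z` given by
a square root `M` of the covariance matrix. -/
theorem integral_multivariateGaussian_zero {d : ℕ} (M : Matrix (Fin d) (Fin d) ℝ)
    (hM : M.det ≠ 0) (F : (Fin d → ℝ) → ℝ) (hF : Continuous F) :
    ∫ h, F h ∂(multivariateGaussian 0 (M * Mᵀ)) =
      ∫ z, F (M *ᵥ z) * ∏ i, ProbabilityTheory.gaussianPDFReal 0 1 (z i) := by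
  set G : (Fin d → ℝ) → ℝ := fun x =>
    Real.exp (-(1/2) * ((x - 0) ⬝ᵥ ((M * Mᵀ)⁻¹ *ᵥ (x - 0)))) /
      Real.sqrt ((2 * Real.pi) ^ d * (M * Mᵀ).det) with hG
  have hGc : Continuous G := by
    rw [hG]
    fun_prop
  have hG0 (x) : 0 ≤ G x := by rw [hG]; positivity
  have h1 : ∫ h, F h ∂(multivariateGaussian 0 (M * Mᵀ)) = ∫ h, G h * F h := by
    change ∫ h, F h ∂(volume.withDensity fun x => ENNReal.ofReal (G x)) = _
    rw [integral_withDensity_eq_integral_toReal_smul (by fun_prop) (by simp)]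
    simp only [ENNReal.toReal_ofReal (hG0 _), smul_eq_mul]
  have h2 := integral_map (μ := (volume : Measure (Fin d → ℝ))) (φ := Matrix.toLin' M)
    (f := fun h => G h * F h)
    (LinearMap.continuous_of_finiteDimensional _).aemeasurable
    (by fun_prop)
  rw [Real.map_matrix_volume_pi_eq_smul_volume_pi hM, integral_smul_measure,
    ENNReal.toReal_ofReal (abs_nonneg _), smul_eq_mul, abs_inv, inv_mul_eq_iff_eq_mul₀ (by simpa),
    ← integral_const_mul] at h2
  rw [h1, h2]
  congr 1
  ext z
  rw [Matrix.toLin'_apply]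
  have hdet : (M * Mᵀ).det = |M.det| ^ 2 := by rw [det_mul, det_transpose, sq_abs, sq]
  have hu : IsUnit M.det := hM.isUnit
  have hq : (M *ᵥ z) ⬝ᵥ ((M * Mᵀ)⁻¹ *ᵥ (M *ᵥ z)) = ∑ i, z i ^ 2 := by
    rw [Matrix.mul_inv_rev, mulVec_mulVec, Matrix.mul_assoc, nonsing_inv_mul M hu, Matrix.mul_one,
      dotProduct_mulVec, ← mulVec_transpose, mulVec_mulVec, transpose_nonsing_inv,
      transpose_transpose, nonsing_inv_mul M hu, one_mulVec]
    simp [dotProduct, sq]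
  have hpdf : ∏ i, ProbabilityTheory.gaussianPDFReal 0 1 (z i) =
      (Real.sqrt (2 * Real.pi) ^ d)⁻¹ * Real.exp (-(1/2) * ∑ i, z i ^ 2) := by
    simp only [ProbabilityTheory.gaussianPDFReal, Finset.prod_mul_distrib, Finset.prod_const,
      ← Real.exp_sum, Finset.mul_sum]
    simp [div_eq_inv_mul]
    rw [← inv_pow, _root_.mul_inv_rev]
  have hs : Real.sqrt ((2 * Real.pi) ^ d * |M.det| ^ 2) =
      Real.sqrt (2 * Real.pi) ^ d * |M.det| := by
    rw [Real.sqrt_eq_iff_mul_self_eq (by positivity) (by positivity), mul_mul_mul_comm,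
      ← mul_pow, Real.mul_self_sqrt (by positivity), sq]
  have : |M.det| ≠ 0 := by simpa
  simp only [hG, sub_zero, hq, hpdf, hdet, hs]
  field_simp

/-- Second moment of the two-layer DGP SC[·], Eq. (17). -/
theorem second_moment_SC (kii kij kjj σ ℓ : ℝ) (hσ : 0 < σ) (hℓ : 0 < ℓ)
    (hK : (!![kii, kij; kij, kjj]).PosDef) :
    (∫ h, σ^2 * Real.cos ((h 0 - h 1) / (2 * ℓ))^2
        ∂(multivariateGaussian 0 !![kii, kij; kij, kjj])) =
      (σ^2 / 2) * (1 + Real.exp ((2 * kij - kii - kjj) / (2 * ℓ^2))) := by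
  have hdet : 0 < kii * kjj - kij * kij := by simpa [det_fin_two] using hK.det_pos
  have hvar : 0 < kii + kjj - 2 * kij := by
    have h := hK.dotProduct_mulVec_pos (x := ![1, -1]) (by simp)
    simp [dotProduct, mulVec, Fin.sum_univ_two] at h
    linarith
  obtain ⟨s, hs, hs2⟩ : ∃ s : ℝ, 0 < s ∧ s ^ 2 = kii + kjj - 2 * kij :=
    ⟨_, Real.sqrt_pos.2 hvar, Real.sq_sqrt hvar.le⟩
  obtain ⟨r, hr, hr2⟩ : ∃ r : ℝ, 0 < r ∧ r ^ 2 = kii * kjj - kij * kij :=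
    ⟨_, Real.sqrt_pos.2 hdet, Real.sq_sqrt hdet.le⟩
  set M : Matrix (Fin 2) (Fin 2) ℝ :=
    !![(kij - kjj) / s + s, r / s; (kij - kjj) / s, r / s] with hM
  have hMM : !![kii, kij; kij, kjj] = M * Mᵀ := by
    have hkii : kii = s ^ 2 - kjj + 2 * kij := by linarith
    ext i j
    fin_cases i <;> fin_cases j <;> simp [hM, Matrix.mul_apply, Fin.sum_univ_two] <;>
      field_simp <;> rw [hr2] <;> subst hkii <;> ring
  have hMdet : M.det ≠ 0 := by
    have : M.det = r := by
      rw [hM, det_fin_two_of]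
      field_simp
      ring
    rw [this]
    exact hr.ne'
  rw [hMM, integral_multivariateGaussian_zero M hMdet _ (by fun_prop)]
  have hprod (z : Fin 2 → ℝ) :
      σ ^ 2 * Real.cos (((M *ᵥ z) 0 - (M *ᵥ z) 1) / (2 * ℓ)) ^ 2 *
        ∏ i, ProbabilityTheory.gaussianPDFReal 0 1 (z i) =
      ∏ i, (![fun x => ProbabilityTheory.gaussianPDFReal 0 1 x *
          (σ ^ 2 * Real.cos (s / (2 * ℓ) * x) ^ 2),
        ProbabilityTheory.gaussianPDFReal 0 1] : Fin 2 → ℝ → ℝ) i (z i) := by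
    have : ((M *ᵥ z) 0 - (M *ᵥ z) 1) / (2 * ℓ) = s / (2 * ℓ) * z 0 := by
      simp [hM, mulVec, dotProduct, Fin.sum_univ_two]
      ring
    rw [this]
    simp [Fin.prod_univ_two]
    ring
  simp only [hprod]
  rw [integral_fintype_prod_volume_eq_prod, Fin.prod_univ_two]
  simp only [cons_val_zero, cons_val_one]
  rw [ProbabilityTheory.integral_gaussianPDFReal_eq_one 0 one_ne_zero, mul_one]
  have h := ProbabilityTheory.integral_gaussianReal_eq_integral_smul (μ := 0) (v := 1)
    (f := fun x => σ ^ 2 * Real.cos (s / (2 * ℓ) * x) ^ 2) one_ne_zero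
  simp only [smul_eq_mul] at h
  rw [← h, integral_cos_sq_gaussianReal]
  congr 3
  have : 2 * kij - kii - kjj = -s ^ 2 := by linarith
  rw [this]
  field_simp
end

section
/- Let (A, B) be a centered bivariate Gaussian vector on ℝ² with positive definite covariance matrix. Then E[exp(-A² - B²)] ≥ E[exp(-A²)] · E[exp(-B²)]. (The inequality of Lemma 4, Eq. (21) of the paper, applied with A = h_i - h_j and B = h_m - h_l.) -/
open MeasureTheory Matrix

/-- The integral over the plane of the exponential of a negative definite quadratic form. -/
theorem integral_exp_neg_quadratic {p q r : ℝ} (hr : 0 < r) (h : 0 < p * r - q ^ 2) :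
    ∫ x : Fin 2 → ℝ, Real.exp (-(p * x 0 ^ 2 + 2 * q * x 0 * x 1 + r * x 1 ^ 2)) =
      Real.pi / Real.sqrt (p * r - q ^ 2) := by
  set s : ℝ := p - q ^ 2 / r with hs
  have hsr : s * r = p * r - q ^ 2 := by rw [hs]; field_simp
  have hs0 : 0 < s := pos_of_mul_pos_left (hsr ▸ h) hr.le
  have hsplit (x y : ℝ) : Real.exp (-(p * x ^ 2 + 2 * q * x * y + r * y ^ 2)) =
      Real.exp (-s * x ^ 2) * Real.exp (-r * (y + q * x / r) ^ 2) := by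
    rw [← Real.exp_add, hs]
    congr 1
    field_simp
    ring
  have hinner (x : ℝ) : ∫ y, Real.exp (-(p * x ^ 2 + 2 * q * x * y + r * y ^ 2)) =
      Real.exp (-s * x ^ 2) * Real.sqrt (Real.pi / r) := by
    simp_rw [hsplit, integral_const_mul]
    rw [integral_add_right_eq_self (fun y => Real.exp (-r * y ^ 2)), integral_gaussian]
  have hint : Integrable
      (fun z : ℝ × ℝ => Real.exp (-(p * z.1 ^ 2 + 2 * q * z.1 * z.2 + r * z.2 ^ 2)))
      (volume.prod volume) := by
    rw [integrable_prod_iff (by fun_prop)]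
    refine ⟨.of_forall fun x => ?_, ?_⟩
    · simp_rw [hsplit]
      exact ((integrable_exp_neg_mul_sq hr).comp_add_right _).const_mul _
    · simp_rw [Real.norm_eq_abs, Real.abs_exp, hinner]
      exact (integrable_exp_neg_mul_sq hs0).mul_const _
  rw [← (volume_preserving_finTwoArrow ℝ).symm.integral_comp
    (MeasurableEquiv.measurableEmbedding _)]
  refine (integral_prod _ hint).trans ?_
  simp_rw [hinner, integral_mul_const]
  rw [integral_gaussian, ← Real.sqrt_mul (by positivity), ← hsr,
    show Real.pi / s * (Real.pi / r) = Real.pi ^ 2 / (s * r) by field_simp,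
    Real.sqrt_div (by positivity), Real.sqrt_sq Real.pi_pos.le]

/-- The Laplace transform of the squares of the coordinates of a centered Gaussian vector in the
plane. -/
theorem integral_exp_neg_sq_multivariateGaussian {K : Matrix (Fin 2) (Fin 2) ℝ} (hK : K.PosDef)
    {s t : ℝ} (hs : 0 ≤ s) (ht : 0 ≤ t) :
    ∫ h, Real.exp (-(s * h 0 ^ 2 + t * h 1 ^ 2)) ∂(multivariateGaussian 0 K) =
      (Real.sqrt (1 + 2 * s * K 0 0 + 2 * t * K 1 1 + 4 * s * t * K.det))⁻¹ := by
  have hD : 0 < K.det := hK.det_pos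
  have ha : 0 < K 0 0 := hK.diag_pos
  have hc : 0 < K 1 1 := hK.diag_pos
  have hsymm : K 1 0 = K 0 1 := by simpa using hK.isHermitian.apply 0 1
  have hdet : K.det = K 0 0 * K 1 1 - K 0 1 ^ 2 := by rw [det_fin_two, hsymm, sq]
  set D := K.det with hDdef
  have hquad (x : Fin 2 → ℝ) : x ⬝ᵥ (K⁻¹ *ᵥ x) =
      (K 1 1 * x 0 ^ 2 - 2 * K 0 1 * x 0 * x 1 + K 0 0 * x 1 ^ 2) / D := by
    rw [Matrix.inv_def, Ring.inverse_eq_inv', adjugate_fin_two, ← hDdef]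
    simp [Matrix.mulVec, dotProduct, Fin.sum_univ_two, hsymm]
    field_simp
    ring
  have hform : (K 1 1 / (2 * D) + s) * (K 0 0 / (2 * D) + t) - (-K 0 1 / (2 * D)) ^ 2 =
      (1 + 2 * s * K 0 0 + 2 * t * K 1 1 + 4 * s * t * D) / (4 * D) := by
    field_simp
    linear_combination -4 * hdet
  rw [multivariateGaussian, integral_withDensity_eq_integral_toReal_smul (by fun_prop) (by simp)]
  have hint (x : Fin 2 → ℝ) :
      (ENNReal.ofReal (Real.exp (-(1/2) * ((x - 0) ⬝ᵥ (K⁻¹ *ᵥ (x - 0)))) /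
        Real.sqrt ((2 * Real.pi) ^ 2 * D))).toReal • Real.exp (-(s * x 0 ^ 2 + t * x 1 ^ 2)) =
      (Real.sqrt ((2 * Real.pi) ^ 2 * D))⁻¹ * Real.exp (-((K 1 1 / (2 * D) + s) * x 0 ^ 2 +
        2 * (-K 0 1 / (2 * D)) * x 0 * x 1 + (K 0 0 / (2 * D) + t) * x 1 ^ 2)) := by
    rw [ENNReal.toReal_ofReal (by positivity), smul_eq_mul, sub_zero, hquad, div_eq_inv_mul,
      mul_assoc, ← Real.exp_add]
    congr 2
    field_simp
    ring
  refine (integral_congr_ae (.of_forall hint)).trans ?_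
  rw [integral_const_mul,
    integral_exp_neg_quadratic (by positivity) (by rw [hform]; positivity), hform,
    Real.sqrt_div (by positivity), Real.sqrt_mul (by positivity), Real.sqrt_mul (by positivity),
    Real.sqrt_sq (by positivity), show Real.sqrt 4 = 2 by
      rw [show (4 : ℝ) = 2 ^ 2 by norm_num, Real.sqrt_sq (by norm_num)]]
  have hD' : 0 < Real.sqrt D := Real.sqrt_pos.2 hD
  field_simp

/-- Lemma 4, Eq. (21): the Gaussian expectation of a product of squared-exponential
factors dominates the product of expectations. -/
theorem exp_neg_sq_covariance_ineq (K : Matrix (Fin 2) (Fin 2) ℝ) (hK : K.PosDef) :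
    (∫ h, Real.exp (-(h 0)^2 - (h 1)^2) ∂(multivariateGaussian 0 K)) ≥
      (∫ h, Real.exp (-(h 0)^2) ∂(multivariateGaussian 0 K)) *
        (∫ h, Real.exp (-(h 1)^2) ∂(multivariateGaussian 0 K)) := by
  have hac := integral_exp_neg_sq_multivariateGaussian hK zero_le_one zero_le_one
  have ha := integral_exp_neg_sq_multivariateGaussian hK zero_le_one le_rfl
  have hc := integral_exp_neg_sq_multivariateGaussian hK le_rfl zero_le_one
  simp only [one_mul, zero_mul, mul_one, mul_zero, add_zero, zero_add, neg_add, ← sub_eq_add_neg]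
    at hac ha hc
  have hD : 0 < K.det := hK.det_pos
  have ha0 : 0 < K 0 0 := hK.diag_pos
  have hc0 : 0 < K 1 1 := hK.diag_pos
  have hsymm : K 1 0 = K 0 1 := by simpa using hK.isHermitian.apply 0 1
  rw [hac, ha, hc, ge_iff_le, ← mul_inv, ← Real.sqrt_mul (by positivity)]
  apply inv_anti₀ (Real.sqrt_pos.2 (by positivity))
  apply Real.sqrt_le_sqrt
  rw [det_fin_two, hsymm]
  nlinarith [sq_nonneg (K 0 1)]
end

section
/- Let (A, B) be a centered bivariate Gaussian vector on ℝ² with positive definite covariance matrix. Then E[cos(A) · cos(B)] ≥ E[cos(A)] · E[cos(B)]. (The inequality of Lemma 5, Eq. (24) of the paper, applied with A = h_i - h_j and B = h_m - h_l.) -/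
open MeasureTheory Matrix

open ProbabilityTheory hiding multivariateGaussian
open scoped NNReal

lemma measurePreserving_shear (r : ℝ) :
    MeasurePreserving (fun z : ℝ × ℝ => ![z.1, r * z.1 + z.2]) volume volume := by
  have h : MeasurePreserving (fun z : ℝ × ℝ => (z.1, r * z.1 + z.2)) volume volume :=
    (MeasurePreserving.id volume).skew_product (g := fun x y => r * x + y) (by fun_prop)
      (Filter.Eventually.of_forall fun x => map_add_left_eq_self volume (r * x))
  exact (volume_preserving_finTwoArrow ℝ).symm.comp h

lemma multivariateGaussian_eq_map_shear (r : ℝ) {v s : ℝ≥0} (hv : v ≠ 0) (hs : s ≠ 0) :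
    multivariateGaussian 0 !![(v : ℝ), r * v; r * v, r ^ 2 * v + s] =
      ((gaussianReal 0 v).prod (gaussianReal 0 s)).map
        fun z : ℝ × ℝ => ![z.1, r * z.1 + z.2] := by
  have hv' : 0 < (v : ℝ) := by positivity
  have hs' : 0 < (s : ℝ) := by positivity
  have hdet : (!![(v : ℝ), r * v; r * v, r ^ 2 * v + s]).det = v * s := by
    rw [det_fin_two_of]; ring
  have hinv : (!![(v : ℝ), r * v; r * v, r ^ 2 * v + s])⁻¹ =
      !![(r ^ 2 * v + s) / (v * s), -r / s; -r / s, 1 / s] := by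
    apply inv_eq_right_inv
    ext i j
    fin_cases i <;> fin_cases j <;> simp [Matrix.mul_apply, Fin.sum_univ_two] <;>
      field_simp <;> ring
  rw [multivariateGaussian, hdet, hinv, gaussianReal_of_var_ne_zero _ hv,
    gaussianReal_of_var_ne_zero _ hs, prod_withDensity (by fun_prop) (by fun_prop),
    ← Measure.volume_eq_prod]
  refine Measure.ext_of_lintegral _ fun f hf => ?_
  have hm : Measurable fun z : ℝ × ℝ => ![z.1, r * z.1 + z.2] :=
    (measurePreserving_shear r).measurable
  rw [lintegral_map hf hm,
    lintegral_withDensity_eq_lintegral_mul _ (by dsimp only [dotProduct, mulVec]; fun_prop) hf,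
    lintegral_withDensity_eq_lintegral_mul _ (by fun_prop)
      (g := fun z : ℝ × ℝ => f ![z.1, r * z.1 + z.2]) (hf.comp hm),
    ← (measurePreserving_shear r).lintegral_comp
      (by dsimp only [dotProduct, mulVec]; fun_prop)]
  refine lintegral_congr fun z => ?_
  simp only [Pi.mul_apply]
  congr 1
  rw [gaussianPDF, gaussianPDF, ← ENNReal.ofReal_mul (gaussianPDFReal_nonneg _ _ _),
    gaussianPDFReal, gaussianPDFReal, mul_mul_mul_comm, ← mul_inv,
    ← Real.sqrt_mul (by positivity), ← Real.exp_add, div_eq_inv_mul]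
  congr 3
  · congr 1; ring
  · simp [vecHead, vecTail]
    field_simp
    ring

lemma integral_cos_add_prod_gaussianReal (v s : ℝ≥0) (p q : ℝ) :
    ∫ z, Real.cos (p * z.1 + q * z.2) ∂((gaussianReal 0 v).prod (gaussianReal 0 s)) =
      Real.exp (-(p ^ 2 * v + q ^ 2 * s) / 2) := by
  have hint : Integrable (fun z : ℝ × ℝ => Complex.exp ((p * z.1 + q * z.2 : ℝ) * Complex.I))
      ((gaussianReal 0 v).prod (gaussianReal 0 s)) :=
    Integrable.of_bound (by fun_prop) 1
      (Filter.Eventually.of_forall fun z => (Complex.norm_exp_ofReal_mul_I _).le)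
  have h : ∫ z, Complex.exp ((p * z.1 + q * z.2 : ℝ) * Complex.I)
      ∂((gaussianReal 0 v).prod (gaussianReal 0 s)) =
      (Real.exp (-(p ^ 2 * v + q ^ 2 * s) / 2) : ℝ) := by
    calc _ = charFun (gaussianReal 0 v) p * charFun (gaussianReal 0 s) q := by
          rw [charFun_apply_real, charFun_apply_real, ← integral_prod_mul]
          congr with z
          rw [← Complex.exp_add]
          push_cast
          ring_nf
      _ = _ := by
          rw [charFun_gaussianReal, charFun_gaussianReal, ← Complex.exp_add, Complex.ofReal_exp]
          push_cast
          ring_nf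
  have hre := congrArg Complex.re h
  rw [Complex.ofReal_re, ← Complex.reCLM_apply, ← Complex.reCLM.integral_comp_comm hint] at hre
  simpa only [Complex.reCLM_apply, Complex.exp_ofReal_mul_I_re] using hre

/-- The characteristic function of the centered Gaussian; it is real-valued by symmetry. -/
lemma integral_cos_multivariateGaussian {K : Matrix (Fin 2) (Fin 2) ℝ} (hK : K.PosDef)
    (p q : ℝ) :
    ∫ h, Real.cos (p * h 0 + q * h 1) ∂(multivariateGaussian 0 K) =
      Real.exp (-(p ^ 2 * K 0 0 + 2 * p * q * K 0 1 + q ^ 2 * K 1 1) / 2) := by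
  have hv : 0 < K 0 0 := hK.diag_pos
  have hsymm : K 1 0 = K 0 1 := by simpa using hK.isHermitian.apply 0 1
  have hdet := hK.det_pos
  rw [det_fin_two, hsymm] at hdet
  obtain ⟨r, hr⟩ : ∃ r, r * K 0 0 = K 0 1 := ⟨K 0 1 / K 0 0, div_mul_cancel₀ _ hv.ne'⟩
  have hs : 0 < K 1 1 - r ^ 2 * K 0 0 := by
    rw [← hr] at hdet
    refine pos_of_mul_pos_right (a := K 0 0) ?_ hv.le
    linarith
  lift K 0 0 to ℝ≥0 using hv.le with v hv_eq
  obtain ⟨s, hs_eq⟩ : ∃ s : ℝ≥0, (s : ℝ) = K 1 1 - r ^ 2 * v := ⟨⟨_, hs.le⟩, rfl⟩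
  have hK_eq : K = !![(v : ℝ), r * v; r * v, r ^ 2 * v + s] := by
    ext i j
    fin_cases i <;> fin_cases j <;> simp [← hv_eq, hr, hsymm, hs_eq]
  have hs0 : s ≠ 0 := by rintro rfl; exact hs.ne hs_eq
  have hv0 : v ≠ 0 := by rintro rfl; simp at hv
  have hshear := multivariateGaussian_eq_map_shear r hv0 hs0
  rw [← hK_eq] at hshear
  rw [hshear, integral_map (measurePreserving_shear r).measurable.aemeasurable
    (by fun_prop)]
  trans ∫ z, Real.cos ((p + q * r) * z.1 + q * z.2) ∂((gaussianReal 0 v).prod (gaussianReal 0 s))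
  · refine integral_congr_ae (Filter.Eventually.of_forall fun z => ?_)
    simp only [cons_val_zero, cons_val_one]
    ring_nf
  · rw [integral_cos_add_prod_gaussianReal, ← hr, hs_eq]
    ring_nf

lemma integrable_cos_multivariateGaussian {K : Matrix (Fin 2) (Fin 2) ℝ} (hK : K.PosDef)
    (p q : ℝ) :
    Integrable (fun h => Real.cos (p * h 0 + q * h 1)) (multivariateGaussian 0 K) :=
  not_not.1 fun h => (Real.exp_pos _).ne'
    ((integral_cos_multivariateGaussian hK p q).symm.trans (integral_undef h))

/-- Lemma 5, Eq. (24): the Gaussian expectation of a product of cosines dominates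
the product of expectations. -/
theorem cos_covariance_ineq (K : Matrix (Fin 2) (Fin 2) ℝ) (hK : K.PosDef) :
    (∫ h, Real.cos (h 0) * Real.cos (h 1) ∂(multivariateGaussian 0 K)) ≥
      (∫ h, Real.cos (h 0) ∂(multivariateGaussian 0 K)) *
        (∫ h, Real.cos (h 1) ∂(multivariateGaussian 0 K)) := by
  have h₀ := integral_cos_multivariateGaussian hK 1 0
  have h₁ := integral_cos_multivariateGaussian hK 0 1
  have hprod : ∫ h, Real.cos (h 0) * Real.cos (h 1) ∂(multivariateGaussian 0 K) =
      (∫ h, Real.cos (1 * h 0 + 1 * h 1) ∂(multivariateGaussian 0 K) +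
        ∫ h, Real.cos (1 * h 0 + -1 * h 1) ∂(multivariateGaussian 0 K)) / 2 := by
    rw [← integral_add (integrable_cos_multivariateGaussian hK 1 1)
      (integrable_cos_multivariateGaussian hK 1 (-1)), ← integral_div]
    congr with h
    simp only [one_mul, neg_mul, Real.cos_add, Real.cos_neg, Real.sin_neg]
    ring
  simp only [one_mul, zero_mul, add_zero, zero_add] at h₀ h₁
  rw [hprod, h₀, h₁, integral_cos_multivariateGaussian hK, integral_cos_multivariateGaussian hK,
    ← Real.exp_add]
  have hcosh := mul_le_mul_of_nonneg_left (Real.one_le_cosh (K 0 1))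
    (Real.exp_pos (-(K 0 0 + K 1 1) / 2)).le
  rw [Real.cosh_eq, mul_one, ← mul_div_assoc, mul_add, ← Real.exp_add, ← Real.exp_add] at hcosh
  ring_nf at hcosh ⊢
  linarith
end

section
/- Let (h_i, h_j, h_m, h_l) be a centered Gaussian vector on ℝ⁴ with positive definite covariance matrix, and let ℓ > 0. Then the sum over the three distinct pairings {(ij)(ml), (im)(jl), (il)(jm)} of E[exp(-(h_a - h_b)²/(2ℓ²)) · exp(-(h_c - h_d)²/(2ℓ²))] is greater than or equal to the sum over the same three pairings of E[exp(-(h_a - h_b)²/(2ℓ²))] · E[exp(-(h_c - h_d)²/(2ℓ²))]. (Remark 2 of the paper for SE[·]: the fourth moment of the true DGP distribution p dominates the fourth moment of the moment-matched Gaussian approximation q.) -/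
open MeasureTheory Matrix

open scoped MatrixOrder in
/-- The Gaussian integral of a positive definite quadratic form. -/
theorem integral_exp_neg_half_dotProduct_mulVec {n : Type*} [Fintype n] [DecidableEq n]
    {A : Matrix n n ℝ} (hA : A.PosDef) :
    ∫ x : n → ℝ, Real.exp (-(1/2) * (x ⬝ᵥ (A *ᵥ x))) =
      Real.sqrt ((2 * Real.pi) ^ Fintype.card n / A.det) := by
  obtain ⟨S, hS⟩ := CStarAlgebra.nonneg_iff_eq_star_mul_self.mp hA.posSemidef.nonneg
  have hS' : A = Sᵀ * S := by simpa [star_eq_conjTranspose] using hS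
  have hdet : A.det = S.det ^ 2 := by rw [hS', det_mul, det_transpose, sq]
  have hS0 : S.det ≠ 0 := fun h => hA.det_pos.ne' (by rw [hdet, h]; simp)
  have hquad (x : n → ℝ) : x ⬝ᵥ (A *ᵥ x) = (toLin' S x) ⬝ᵥ (toLin' S x) := by
    rw [hS', ← mulVec_mulVec, dotProduct_mulVec, vecMul_transpose, toLin'_apply]
  have hcont : Continuous fun y : n → ℝ => Real.exp (-(1/2) * (y ⬝ᵥ y)) := by
    unfold dotProduct; fun_prop
  have hstd : ∫ y : n → ℝ, Real.exp (-(1/2) * (y ⬝ᵥ y)) =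
      Real.sqrt (2 * Real.pi) ^ Fintype.card n := by
    have h (y : n → ℝ) : Real.exp (-(1/2) * (y ⬝ᵥ y)) =
        ∏ i, Real.exp (-(1/2) * y i ^ 2) := by
      rw [← Real.exp_sum, dotProduct, Finset.mul_sum]
      simp_rw [sq]
    simp_rw [h]
    rw [integral_fintype_prod_volume_eq_pow fun t : ℝ => Real.exp (-(1/2) * t ^ 2),
      integral_gaussian]
    congr 2
    ring
  simp_rw [hquad]
  rw [← integral_map (φ := toLin' S) (f := fun y => Real.exp (-(1/2) * (y ⬝ᵥ y)))
    (LinearMap.continuous_of_finiteDimensional _).aemeasurable hcont.aestronglyMeasurable,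
    Real.map_matrix_volume_pi_eq_smul_volume_pi hS0, integral_smul_measure, hstd, hdet,
    ENNReal.toReal_ofReal (abs_nonneg _), smul_eq_mul, Real.sqrt_div (by positivity),
    Real.sqrt_sq_eq_abs, abs_inv, ← div_eq_inv_mul]
  congr 1
  rw [eq_comm, Real.sqrt_eq_iff_mul_self_eq (by positivity) (by positivity), ← mul_pow,
    Real.mul_self_sqrt (by positivity)]

theorem det_one_add_mul_mul_transpose_pos {m n : Type*} [Fintype m] [DecidableEq m] [Fintype n]
    {K : Matrix n n ℝ} (hK : K.PosDef) (W : Matrix m n ℝ) : 0 < (1 + W * K * Wᵀ).det := by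
  have h := hK.posSemidef.mul_mul_conjTranspose_same W
  rw [conjTranspose_eq_transpose_of_trivial] at h
  exact (PosDef.one.add_posSemidef h).det_pos

/-- The expectation of `exp (-‖W h‖² / 2)` under a centered Gaussian vector `h`. -/
theorem integral_exp_neg_half_mulVec_multivariateGaussian {d : ℕ} {m : Type*} [Fintype m]
    [DecidableEq m] {K : Matrix (Fin d) (Fin d) ℝ} (hK : K.PosDef) (W : Matrix m (Fin d) ℝ) :
    ∫ h, Real.exp (-(1/2) * ((W *ᵥ h) ⬝ᵥ (W *ᵥ h))) ∂(multivariateGaussian 0 K) =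
      (Real.sqrt (1 + W * K * Wᵀ).det)⁻¹ := by
  have hP : (K⁻¹ + Wᵀ * W).PosDef := by
    simpa using hK.inv.add_posSemidef (posSemidef_conjTranspose_mul_self W)
  have hdet : (K⁻¹ + Wᵀ * W).det = K.det⁻¹ * (1 + W * K * Wᵀ).det := by
    rw [det_add_mul _ _ ((isUnit_iff_isUnit_det _).1 hK.inv.isUnit), det_nonsing_inv,
      Ring.inverse_eq_inv', nonsing_inv_nonsing_inv _ ((isUnit_iff_isUnit_det _).1 hK.isUnit)]
  have hKd := hK.det_pos
  have hmeas : Measurable fun x : Fin d → ℝ =>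
      ENNReal.ofReal (Real.exp (-(1/2) * ((x - 0) ⬝ᵥ (K⁻¹ *ᵥ (x - 0)))) /
        Real.sqrt ((2 * Real.pi) ^ d * K.det)) := by
    unfold mulVec dotProduct
    fun_prop
  rw [multivariateGaussian, integral_withDensity_eq_integral_toReal_smul hmeas (by simp)]
  have hintegrand (h : Fin d → ℝ) :
      (ENNReal.ofReal (Real.exp (-(1/2) * ((h - 0) ⬝ᵥ (K⁻¹ *ᵥ (h - 0)))) /
        Real.sqrt ((2 * Real.pi) ^ d * K.det))).toReal •
        Real.exp (-(1/2) * ((W *ᵥ h) ⬝ᵥ (W *ᵥ h))) =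
      (Real.sqrt ((2 * Real.pi) ^ d * K.det))⁻¹ *
        Real.exp (-(1/2) * (h ⬝ᵥ ((K⁻¹ + Wᵀ * W) *ᵥ h))) := by
    rw [ENNReal.toReal_ofReal (by positivity), smul_eq_mul, sub_zero, add_mulVec,
      dotProduct_add, ← mulVec_mulVec, dotProduct_mulVec h Wᵀ, vecMul_transpose, mul_add,
      Real.exp_add]
    ring
  simp_rw [hintegrand]
  rw [integral_const_mul, integral_exp_neg_half_dotProduct_mulVec hP, hdet, Fintype.card_fin,
    ← Real.sqrt_inv, ← Real.sqrt_inv, ← Real.sqrt_mul (by positivity)]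
  congr 1
  have : 0 < (2 * Real.pi) ^ d := by positivity
  field_simp

/-- Squared-exponential functionals of linear forms of a centered Gaussian vector are
nonnegatively correlated. -/
theorem integral_mul_integral_le_integral_exp_neg_sq_mul {d : ℕ}
    {K : Matrix (Fin d) (Fin d) ℝ} (hK : K.PosDef) (u v : Fin d → ℝ) :
    (∫ h, Real.exp (-(1/2) * (u ⬝ᵥ h) ^ 2) ∂(multivariateGaussian 0 K)) *
        (∫ h, Real.exp (-(1/2) * (v ⬝ᵥ h) ^ 2) ∂(multivariateGaussian 0 K)) ≤
      ∫ h, Real.exp (-(1/2) * (u ⬝ᵥ h) ^ 2) * Real.exp (-(1/2) * (v ⬝ᵥ h) ^ 2)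
        ∂(multivariateGaussian 0 K) := by
  have hentry {n : ℕ} (W : Matrix (Fin n) (Fin d) ℝ) (i j : Fin n) :
      (1 + W * K * Wᵀ : Matrix (Fin n) (Fin n) ℝ) i j = (1 : Matrix (Fin n) (Fin n) ℝ) i j + W i ⬝ᵥ (K *ᵥ W j) := by
    rw [Matrix.add_apply, Matrix.mul_assoc, mul_apply']
    rfl
  have hone (w : Fin d → ℝ) :
      ∫ h, Real.exp (-(1/2) * (w ⬝ᵥ h) ^ 2) ∂(multivariateGaussian 0 K) =
        (Real.sqrt (1 + w ⬝ᵥ (K *ᵥ w)))⁻¹ := by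
    have := integral_exp_neg_half_mulVec_multivariateGaussian hK (of ![w])
    rw [det_fin_one, hentry] at this
    simpa [sq, mulVec, dotProduct] using this
  have hpos (w : Fin d → ℝ) : 0 < 1 + w ⬝ᵥ (K *ᵥ w) := by
    have := hK.posSemidef.dotProduct_mulVec_nonneg w
    simp only [star_trivial] at this
    linarith
  have hsymm : v ⬝ᵥ (K *ᵥ u) = u ⬝ᵥ (K *ᵥ v) := by
    have hKt : Kᵀ = K := by simpa using hK.isHermitian.eq
    rw [dotProduct_mulVec, ← mulVec_transpose, hKt, dotProduct_comm]
  have hjoint := integral_exp_neg_half_mulVec_multivariateGaussian hK (of ![u, v])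
  have hjointpos := det_one_add_mul_mul_transpose_pos hK (of ![u, v])
  have hdet : (1 + of ![u, v] * K * (of ![u, v])ᵀ).det =
      (1 + u ⬝ᵥ (K *ᵥ u)) * (1 + v ⬝ᵥ (K *ᵥ v)) - (u ⬝ᵥ (K *ᵥ v)) ^ 2 := by
    rw [det_fin_two, hentry, hentry, hentry, hentry]
    have hu : of ![u, v] 0 = u := rfl
    have hv : of ![u, v] 1 = v := rfl
    simp [hu, hv, hsymm, sq]
  have hsum (h : Fin d → ℝ) : Real.exp (-(1/2) * (u ⬝ᵥ h) ^ 2) *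
      Real.exp (-(1/2) * (v ⬝ᵥ h) ^ 2) =
      Real.exp (-(1/2) * ((of ![u, v] *ᵥ h) ⬝ᵥ (of ![u, v] *ᵥ h))) := by
    rw [← Real.exp_add]
    congr 1
    simp [sq, mul_add]
  simp_rw [hsum, hjoint, hone]
  rw [← mul_inv, ← Real.sqrt_mul (hpos u).le]
  refine inv_anti₀ (Real.sqrt_pos.2 hjointpos) (Real.sqrt_le_sqrt ?_)
  rw [hdet]
  linarith [sq_nonneg (u ⬝ᵥ (K *ᵥ v))]

/-- Squared-exponential kernels evaluated at two pairs of coordinates of a centered Gaussian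
vector are nonnegatively correlated. -/
theorem integral_sqExp_mul_integral_sqExp_le {d : ℕ}
    {K : Matrix (Fin d) (Fin d) ℝ} (hK : K.PosDef) (ℓ : ℝ) (a b i j : Fin d) :
    (∫ h, Real.exp (-(h a - h b)^2 / (2 * ℓ^2)) ∂(multivariateGaussian 0 K)) *
        (∫ h, Real.exp (-(h i - h j)^2 / (2 * ℓ^2)) ∂(multivariateGaussian 0 K)) ≤
      ∫ h, Real.exp (-(h a - h b)^2 / (2 * ℓ^2)) * Real.exp (-(h i - h j)^2 / (2 * ℓ^2))
        ∂(multivariateGaussian 0 K) := by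
  have hker (a b : Fin d) (h : Fin d → ℝ) : Real.exp (-(h a - h b)^2 / (2 * ℓ^2)) =
      Real.exp (-(1/2) * ((ℓ⁻¹ • (Pi.single a 1 - Pi.single b 1) : Fin d → ℝ) ⬝ᵥ h) ^ 2) := by
    rw [smul_dotProduct, sub_dotProduct, single_one_dotProduct, single_one_dotProduct,
      smul_eq_mul, mul_pow, inv_pow, div_eq_mul_inv, mul_inv]
    ring_nf
  simp_rw [hker]
  exact integral_mul_integral_le_integral_exp_neg_sq_mul hK _ _

/-- Remark 2 for SE[·]: the fourth moment of the true DGP distribution dominates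
that of the moment-matched Gaussian approximation, as a sum over the three pairings. -/
theorem fourth_moment_p_ge_q (K : Matrix (Fin 4) (Fin 4) ℝ) (hK : K.PosDef)
    (ℓ : ℝ) (hℓ : 0 < ℓ) :
    (∫ h, Real.exp (-(h 0 - h 1)^2 / (2 * ℓ^2)) * Real.exp (-(h 2 - h 3)^2 / (2 * ℓ^2))
        ∂(multivariateGaussian 0 K)) +
      (∫ h, Real.exp (-(h 0 - h 2)^2 / (2 * ℓ^2)) * Real.exp (-(h 1 - h 3)^2 / (2 * ℓ^2))
        ∂(multivariateGaussian 0 K)) +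
      (∫ h, Real.exp (-(h 0 - h 3)^2 / (2 * ℓ^2)) * Real.exp (-(h 1 - h 2)^2 / (2 * ℓ^2))
        ∂(multivariateGaussian 0 K)) ≥
    (∫ h, Real.exp (-(h 0 - h 1)^2 / (2 * ℓ^2)) ∂(multivariateGaussian 0 K)) *
        (∫ h, Real.exp (-(h 2 - h 3)^2 / (2 * ℓ^2)) ∂(multivariateGaussian 0 K)) +
      (∫ h, Real.exp (-(h 0 - h 2)^2 / (2 * ℓ^2)) ∂(multivariateGaussian 0 K)) *
        (∫ h, Real.exp (-(h 1 - h 3)^2 / (2 * ℓ^2)) ∂(multivariateGaussian 0 K)) +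
      (∫ h, Real.exp (-(h 0 - h 3)^2 / (2 * ℓ^2)) ∂(multivariateGaussian 0 K)) *
        (∫ h, Real.exp (-(h 1 - h 2)^2 / (2 * ℓ^2)) ∂(multivariateGaussian 0 K)) := by
  exact add_le_add (add_le_add
    (integral_sqExp_mul_integral_sqExp_le hK ℓ 0 1 2 3)
    (integral_sqExp_mul_integral_sqExp_le hK ℓ 0 2 1 3))
    (integral_sqExp_mul_integral_sqExp_le hK ℓ 0 3 1 2)
end

section
/- Let x, y ∈ ℝ^D with x ≠ y, let σ₁, σ₂, ℓ₁, ℓ₂ > 0, and let (h_i, h_j) be a centered bivariate Gaussian vector on ℝ² with covariance matrix [[σ₁², σ₁² exp(-‖x-y‖²/(2ℓ₁²))], [σ₁² exp(-‖x-y‖²/(2ℓ₁²)), σ₁²]] (which is positive definite since x ≠ y). Then E[σ₂² exp(-(h_i - h_j)²/(2ℓ₂²))] = σ₂² (1 + (2σ₁²/ℓ₂²)(1 - exp(-‖x-y‖²/(2ℓ₁²))))^{-1/2}. (The effective covariance function of SE[SE], Eq. (30) of the paper.) -/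
open MeasureTheory Matrix

/-- A Gaussian integral over the plane whose quadratic form is diagonal in the coordinates
`h 0 - h 1` and `h 0 + h 1`. -/
lemma integral_exp_neg_mul_sub_sq_sub_mul_add_sq (a b : ℝ) :
    ∫ h : Fin 2 → ℝ, Real.exp (-a * (h 0 - h 1) ^ 2) * Real.exp (-b * (h 0 + h 1) ^ 2) =
      √(Real.pi / a) * √(Real.pi / b) / 2 := by
  have hdet : (!![1, -1; 1, 1] : Matrix (Fin 2) (Fin 2) ℝ).det = 2 := by
    rw [det_fin_two_of]; norm_num
  have hmap := Real.map_matrix_volume_pi_eq_smul_volume_pi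
    (M := (!![1, -1; 1, 1] : Matrix (Fin 2) (Fin 2) ℝ)) (by rw [hdet]; norm_num)
  have hprod := integral_fintype_prod_volume_eq_prod
    (fun (i : Fin 2) (t : ℝ) => Real.exp (-(![a, b] i) * t ^ 2))
  simp only [Fin.prod_univ_two, cons_val_zero, cons_val_one, integral_gaussian] at hprod
  have hchange := integral_map (μ := (volume : Measure (Fin 2 → ℝ)))
    (φ := toLin' (!![1, -1; 1, 1] : Matrix (Fin 2) (Fin 2) ℝ))
    (LinearMap.continuous_of_finiteDimensional _).measurable.aemeasurable
    (f := fun g => Real.exp (-a * g 0 ^ 2) * Real.exp (-b * g 1 ^ 2))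
    (Continuous.aestronglyMeasurable (by fun_prop))
  rw [hmap, hdet, integral_smul_measure, hprod, ENNReal.toReal_ofReal (abs_nonneg _),
    abs_of_pos (by norm_num), smul_eq_mul] at hchange
  simp only [toLin'_apply, mulVec, dotProduct, Fin.sum_univ_two, of_apply, cons_val_zero,
    cons_val_one, one_mul, neg_mul, ← sub_eq_add_neg] at hchange
  simp only [neg_mul]
  rw [← hchange]
  ring

/-- The expectation of `exp (-c * (h 0 - h 1) ^ 2)` when `h` is a centered Gaussian pair with
common variance `s` and correlation `r`. -/
lemma integral_exp_neg_mul_sub_sq_multivariateGaussian {s r c : ℝ} (hs : 0 < s)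
    (hr : -1 < r) (hr' : r < 1) (hc : 0 ≤ c) :
    ∫ h, Real.exp (-c * (h 0 - h 1) ^ 2)
        ∂(multivariateGaussian 0 !![s, s * r; s * r, s]) =
      (1 + 4 * s * c * (1 - r)) ^ (-(1 : ℝ) / 2) := by
  have h₁ : 0 < 1 - r := by linarith
  have h₂ : 0 < 1 + r := by linarith
  have hdet : (!![s, s * r; s * r, s] : Matrix (Fin 2) (Fin 2) ℝ).det =
      s ^ 2 * ((1 - r) * (1 + r)) := by
    rw [det_fin_two_of]; ring
  have hquad (h : Fin 2 → ℝ) :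
      h ⬝ᵥ ((!![s, s * r; s * r, s] : Matrix (Fin 2) (Fin 2) ℝ)⁻¹ *ᵥ h) =
        (h 0 - h 1) ^ 2 / (2 * s * (1 - r)) + (h 0 + h 1) ^ 2 / (2 * s * (1 + r)) := by
    rw [inv_def, hdet, adjugate_fin_two_of, Ring.inverse_eq_inv']
    simp only [dotProduct, mulVec, Fin.sum_univ_two, Matrix.smul_apply, of_apply, cons_val',
      cons_val_zero, cons_val_one, cons_val_fin_one, smul_eq_mul]
    field_simp
    ring
  have hmeas : Measurable fun h : Fin 2 → ℝ =>
      ENNReal.ofReal (Real.exp (-(1/2) * ((h - 0) ⬝ᵥ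
        ((!![s, s * r; s * r, s] : Matrix (Fin 2) (Fin 2) ℝ)⁻¹ *ᵥ (h - 0)))) /
        √((2 * Real.pi) ^ 2 * (!![s, s * r; s * r, s] : Matrix (Fin 2) (Fin 2) ℝ).det)) := by
    simp only [sub_zero, hquad]
    fun_prop
  rw [multivariateGaussian, integral_withDensity_eq_integral_toReal_smul hmeas (by simp)]
  simp only [sub_zero, hquad, hdet, smul_eq_mul]
  have hintegrand (h : Fin 2 → ℝ) :
      (ENNReal.ofReal (Real.exp (-(1/2) * ((h 0 - h 1) ^ 2 / (2 * s * (1 - r)) +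
        (h 0 + h 1) ^ 2 / (2 * s * (1 + r)))) /
        √((2 * Real.pi) ^ 2 * (s ^ 2 * ((1 - r) * (1 + r)))))).toReal *
        Real.exp (-c * (h 0 - h 1) ^ 2) =
      (Real.exp (-(1 / (4 * s * (1 - r)) + c) * (h 0 - h 1) ^ 2) *
        Real.exp (-(1 / (4 * s * (1 + r))) * (h 0 + h 1) ^ 2)) /
        √((2 * Real.pi) ^ 2 * (s ^ 2 * ((1 - r) * (1 + r)))) := by
    rw [ENNReal.toReal_ofReal (by positivity), div_mul_eq_mul_div, ← Real.exp_add,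
      ← Real.exp_add]
    congr 2
    field_simp
    ring
  simp only [hintegrand]
  have hpos : 0 < 1 + 4 * s * c * (1 - r) := by positivity
  rw [integral_div, integral_exp_neg_mul_sub_sq_sub_mul_add_sq, neg_div, Real.rpow_neg hpos.le,
    ← Real.sqrt_eq_rpow, ← Real.sqrt_mul (by positivity), ← Real.sqrt_inv, div_right_comm,
    ← Real.sqrt_div (by positivity), div_eq_iff two_ne_zero, ← Real.sqrt_sq zero_le_two,
    ← Real.sqrt_mul (by positivity), Real.sqrt_sq zero_le_two]
  congr 1
  field_simp
  ring

/-- The effective covariance function of SE[SE], Eq. (30). -/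
theorem effective_kernel_SESE (D : ℕ) (x y : EuclideanSpace ℝ (Fin D)) (hxy : x ≠ y)
    (σ₁ σ₂ ℓ₁ ℓ₂ : ℝ) (hσ₁ : 0 < σ₁) (hσ₂ : 0 < σ₂) (hℓ₁ : 0 < ℓ₁) (hℓ₂ : 0 < ℓ₂) :
    (∫ h, σ₂^2 * Real.exp (-(h 0 - h 1)^2 / (2 * ℓ₂^2))
        ∂(multivariateGaussian 0
          !![σ₁^2, σ₁^2 * Real.exp (-‖x - y‖^2 / (2 * ℓ₁^2));
             σ₁^2 * Real.exp (-‖x - y‖^2 / (2 * ℓ₁^2)), σ₁^2])) =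
      σ₂^2 * (1 + (2 * σ₁^2 / ℓ₂^2) * (1 - Real.exp (-‖x - y‖^2 / (2 * ℓ₁^2))))
        ^ (-(1:ℝ)/2) := by
  have hexp : Real.exp (-‖x - y‖^2 / (2 * ℓ₁^2)) < 1 := by
    have hnorm : 0 < ‖x - y‖ := norm_pos_iff.mpr (sub_ne_zero.mpr hxy)
    rw [Real.exp_lt_one_iff, neg_div, neg_lt_zero]
    positivity
  have hgauss := integral_exp_neg_mul_sub_sq_multivariateGaussian (s := σ₁^2)
    (c := 1 / (2 * ℓ₂^2)) (by positivity)
    ((by norm_num : (-1 : ℝ) < 0).trans (Real.exp_pos _)) hexp (by positivity)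
  have hexponent (t : ℝ) : -t^2 / (2 * ℓ₂^2) = -(1 / (2 * ℓ₂^2)) * t^2 := by ring
  have hcoeff : 2 * σ₁^2 / ℓ₂^2 = 4 * σ₁^2 * (1 / (2 * ℓ₂^2)) := by ring
  simp only [hexponent]
  rw [integral_const_mul, hgauss, hcoeff]
end

section
/- Let w be a standard Gaussian random vector on ℝ^D (i.i.d. standard normal coordinates), let x, y ∈ ℝ^D with x ≠ y, and let σ > 0, ℓ > 0. Then E[σ² exp(-(⟨w, x⟩ - ⟨w, y⟩)²/(2ℓ²))] = σ² (1 + ‖x - y‖²/ℓ²)^{-1/2}. (SE[Lin]: composing a linear kernel k(x,y) = ⟨x,y⟩ into an SE output layer yields the rational quadratic kernel of order 1/2.) -/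
open MeasureTheory RealInnerProductSpace

/-- The standard Gaussian measure on `ℝ^D` (i.i.d. standard normal coordinates),
defined via its density with respect to Lebesgue measure. -/
noncomputable def stdGaussian (D : ℕ) : Measure (EuclideanSpace ℝ (Fin D)) :=
  volume.withDensity fun w =>
    ENNReal.ofReal (Real.exp (-(1/2) * ‖w‖^2) / Real.sqrt ((2 * Real.pi) ^ D))

theorem integral_exp_neg_sum_mul_sq {ι : Type*} [Fintype ι] (c : ι → ℝ) :
    ∫ w : EuclideanSpace ℝ ι, Real.exp (-∑ i, c i * w i ^ 2) = ∏ i, √(Real.pi / c i) := by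
  rw [← (PiLp.volume_preserving_toLp ι).integral_comp
    (MeasurableEquiv.toLp 2 (ι → ℝ)).measurableEmbedding]
  simp only [← Finset.sum_neg_distrib, Real.exp_sum, ← neg_mul]
  rw [integral_fintype_prod_volume_eq_prod (fun i (t : ℝ) => Real.exp (-c i * t ^ 2))]
  simp only [integral_gaussian]

theorem integral_exp_neg_mul_sq_norm_sub_mul_inner_sq {ι E : Type*} [Fintype ι]
    [NormedAddCommGroup E] [InnerProductSpace ℝ E] [FiniteDimensional ℝ E] [MeasurableSpace E]
    [BorelSpace E] (b : OrthonormalBasis ι ℝ E) (j : ι) (a c : ℝ) (ha : 0 < a) (hc : 0 ≤ c) :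
    ∫ w : E, Real.exp (-a * ‖w‖ ^ 2 - c * ⟪b j, w⟫ ^ 2) =
      √(Real.pi / a) ^ Fintype.card ι * √(a / (a + c)) := by
  classical
  have hcoord : ∀ w : E, Real.exp (-a * ‖w‖ ^ 2 - c * ⟪b j, w⟫ ^ 2) =
      (fun v : EuclideanSpace ℝ ι =>
        Real.exp (-∑ i, (a + if i = j then c else 0) * v i ^ 2)) (b.repr w) := by
    intro w
    simp only [add_mul, Finset.sum_add_distrib, ← Finset.mul_sum, ite_mul, zero_mul,
      Finset.sum_ite_eq', Finset.mem_univ, if_true, b.repr_apply_apply, b.sum_sq_inner_right]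
    ring_nf
  rw [integral_congr_ae (.of_forall hcoord)]
  refine (b.measurePreserving_measurableEquiv.integral_comp' (fun v : EuclideanSpace ℝ ι =>
    Real.exp (-∑ i, (a + if i = j then c else 0) * v i ^ 2))).trans ?_
  rw [integral_exp_neg_sum_mul_sq]
  have hac : 0 < a + c := by positivity
  have hsplit : ∀ i, √(Real.pi / (a + if i = j then c else 0)) =
      √(Real.pi / a) * if i = j then √(a / (a + c)) else 1 := by
    intro i
    split_ifs
    · rw [← Real.sqrt_mul (by positivity)]
      congr 1
      field_simp
    · simp
  simp_rw [hsplit, Finset.prod_mul_distrib]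
  simp

theorem OrthonormalBasis.exists_apply_eq {E : Type*} [NormedAddCommGroup E]
    [InnerProductSpace ℝ E] [FiniteDimensional ℝ E] {ι : Type*} [Fintype ι]
    (hι : Module.finrank ℝ E = Fintype.card ι) (u : E) (hu : ‖u‖ = 1) :
    ∃ (b : OrthonormalBasis ι ℝ E) (j : ι), b j = u := by
  have hne : Nonempty ι := by
    rw [← Fintype.card_pos_iff, ← hι, Module.finrank_pos_iff_exists_ne_zero]
    exact ⟨u, by rintro rfl; simp at hu⟩
  obtain ⟨j⟩ := hne
  have hv : Orthonormal ℝ (({j} : Set ι).domRestrict fun _ => u) :=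
    ⟨fun _ => hu, fun i k hik => (hik (Subsingleton.elim i k)).elim⟩
  obtain ⟨b, hb⟩ := hv.exists_orthonormalBasis_extension_of_card_eq hι
  exact ⟨b, j, hb j rfl⟩

theorem integral_stdGaussian (D : ℕ) (f : EuclideanSpace ℝ (Fin D) → ℝ) :
    ∫ w, f w ∂(stdGaussian D) =
      (√((2 * Real.pi) ^ D))⁻¹ * ∫ w, Real.exp (-(1/2) * ‖w‖^2) * f w := by
  rw [stdGaussian, integral_withDensity_eq_integral_toReal_smul (by fun_prop)
    (Filter.Eventually.of_forall fun _ => ENNReal.ofReal_lt_top), ← integral_const_mul]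
  congr 1 with w
  rw [ENNReal.toReal_ofReal (by positivity), smul_eq_mul]
  ring

/-- SE[Lin]: composing a linear kernel into an SE output layer yields the rational
quadratic kernel of order 1/2. -/
theorem effective_kernel_SELin (D : ℕ) (x y : EuclideanSpace ℝ (Fin D)) (hxy : x ≠ y)
    (σ ℓ : ℝ) (hσ : 0 < σ) (hℓ : 0 < ℓ) :
    (∫ w, σ^2 * Real.exp (-(⟪w, x⟫ - ⟪w, y⟫)^2 / (2 * ℓ^2)) ∂(stdGaussian D)) =
      σ^2 * (1 + ‖x - y‖^2 / ℓ^2) ^ (-(1:ℝ)/2) := by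
  have hr : 0 < ‖x - y‖ := norm_pos_iff.mpr (sub_ne_zero.mpr hxy)
  obtain ⟨b, j, hb⟩ := OrthonormalBasis.exists_apply_eq (ι := Fin D)
    (by simp) (‖x - y‖⁻¹ • (x - y)) (by rw [norm_smul, norm_inv, norm_norm]; field_simp)
  have hinner : ∀ w : EuclideanSpace ℝ (Fin D), ⟪w, x⟫ - ⟪w, y⟫ = ‖x - y‖ * ⟪b j, w⟫ := by
    intro w
    rw [hb, real_inner_smul_left, ← inner_sub_right, real_inner_comm w]
    field_simp
  have hexp : ∀ w : EuclideanSpace ℝ (Fin D),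
      Real.exp (-(1/2) * ‖w‖^2) * Real.exp (-(⟪w, x⟫ - ⟪w, y⟫)^2 / (2 * ℓ^2)) =
        Real.exp (-(1/2) * ‖w‖^2 - ‖x - y‖^2 / (2 * ℓ^2) * ⟪b j, w⟫ ^ 2) := by
    intro w
    rw [← Real.exp_add, hinner]
    congr 1
    ring
  rw [integral_const_mul, integral_stdGaussian]
  simp only [hexp]
  rw [integral_exp_neg_mul_sq_norm_sub_mul_inner_sq b j _ _ (by norm_num) (by positivity),
    Fintype.card_fin, neg_div, Real.rpow_neg (by positivity), ← Real.sqrt_eq_rpow,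
    ← Real.sqrt_inv, ← Real.sqrt_inv, ← mul_assoc (√_) (√_ ^ D)]
  have hpow : √(((2 * Real.pi) ^ D)⁻¹) * √(Real.pi / (1/2)) ^ D = 1 := by
    have h2 : Real.pi / (1/2) = 2 * Real.pi := by ring
    have hsqrt : √((2 * Real.pi) ^ D) = √(2 * Real.pi) ^ D := by
      rw [Real.sqrt_eq_iff_mul_self_eq (by positivity) (by positivity), ← mul_pow,
        Real.mul_self_sqrt (by positivity)]
    rw [h2, Real.sqrt_inv, hsqrt, inv_mul_cancel₀ (by positivity)]
  rw [hpow, one_mul]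
  congr 2
  field_simp
end

section
/- Let w be a standard Gaussian random vector on ℝ^D (i.i.d. standard normal coordinates), let x, y ∈ ℝ^D, and let σ > 0, ℓ > 0. Then E[σ² cos²((⟨w, x⟩ - ⟨w, y⟩)/(2ℓ))] = (σ²/2) (1 + exp(-‖x - y‖²/(2ℓ²))). (SC[Lin]: composing a linear kernel into a squared cosine output layer yields the sum of a squared exponential kernel and a constant kernel.) -/
open MeasureTheory RealInnerProductSpace

/-- The characteristic function of the standard Gaussian measure. -/
theorem charFun_stdGaussian_eq (D : ℕ) (t : EuclideanSpace ℝ (Fin D)) :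
    charFun (stdGaussian D) t = Complex.exp (-‖t‖ ^ 2 / 2) := by
  have hpos : (0 : ℝ) < (2 * Real.pi) ^ D := by positivity
  have hint := GaussianFourier.integral_cexp_neg_mul_sq_norm_add
    (b := 1 / 2) (by norm_num) Complex.I t
  have hpow : ((Real.pi : ℂ) / (1 / 2)) ^ ((D : ℂ) / 2) = (√((2 * Real.pi) ^ D) : ℝ) := by
    rw [Real.sqrt_eq_rpow, ← Real.rpow_natCast, ← Real.rpow_mul (by positivity),
      Complex.ofReal_cpow (by positivity)]
    push_cast
    congr 1 <;> ring
  rw [finrank_euclideanSpace_fin, hpow] at hint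
  rw [charFun_apply, stdGaussian, integral_withDensity_eq_integral_toReal_smul (by fun_prop)
    (by simp)]
  have hdens : ∀ w : EuclideanSpace ℝ (Fin D),
      (ENNReal.ofReal (Real.exp (-(1/2) * ‖w‖^2) / √((2 * Real.pi) ^ D))).toReal •
        Complex.exp (⟪w, t⟫ * Complex.I) =
      (√((2 * Real.pi) ^ D) : ℂ)⁻¹ *
        Complex.exp (-(1 / 2) * ‖w‖ ^ 2 + Complex.I * ⟪t, w⟫) := by
    intro w
    rw [ENNReal.toReal_ofReal (by positivity), Complex.real_smul, Complex.exp_add,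
      real_inner_comm]
    push_cast
    ring_nf
  simp_rw [hdens]
  rw [integral_const_mul, hint, inv_mul_cancel_left₀ (by
    exact_mod_cast (Real.sqrt_pos.2 hpos).ne')]
  congr 1
  rw [Complex.I_sq]
  ring

instance isProbabilityMeasure_stdGaussian (D : ℕ) : IsProbabilityMeasure (stdGaussian D) := by
  have h : (stdGaussian D).real Set.univ = 1 := by
    have h0 := charFun_stdGaussian_eq D 0
    rw [charFun_zero] at h0
    exact_mod_cast (by simpa using h0 : (((stdGaussian D).real Set.univ : ℝ) : ℂ) = 1)
  exact ⟨by simpa [measureReal_def, ENNReal.toReal_eq_one_iff] using h⟩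

theorem integral_cos_inner_stdGaussian (D : ℕ) (t : EuclideanSpace ℝ (Fin D)) :
    ∫ w, Real.cos ⟪w, t⟫ ∂(stdGaussian D) = Real.exp (-‖t‖ ^ 2 / 2) := by
  have hint : Integrable (fun w => Complex.exp (⟪w, t⟫ * Complex.I)) (stdGaussian D) :=
    Integrable.of_bound (by fun_prop) 1 (by simp [Complex.norm_exp_ofReal_mul_I])
  have h := congrArg Complex.re (charFun_stdGaussian_eq D t)
  rw [charFun_apply] at h
  have hre := integral_re hint
  simp only [RCLike.re_eq_complex_re, Complex.exp_ofReal_mul_I_re] at hre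
  rw [hre, h, ← Complex.exp_ofReal_re]
  push_cast
  rfl

/-- SC[Lin]: composing a linear kernel into a squared cosine output layer yields the
sum of a squared exponential kernel and a constant kernel. -/
theorem effective_kernel_SCLin (D : ℕ) (x y : EuclideanSpace ℝ (Fin D))
    (σ ℓ : ℝ) (hσ : 0 < σ) (hℓ : 0 < ℓ) :
    (∫ w, σ^2 * Real.cos ((⟪w, x⟫ - ⟪w, y⟫) / (2 * ℓ))^2 ∂(stdGaussian D)) =
      (σ^2 / 2) * (1 + Real.exp (-‖x - y‖^2 / (2 * ℓ^2))) := by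
  have hcos : ∀ w : EuclideanSpace ℝ (Fin D),
      σ^2 * Real.cos ((⟪w, x⟫ - ⟪w, y⟫) / (2 * ℓ))^2 =
        (σ^2 / 2) * (1 + Real.cos ⟪w, ℓ⁻¹ • (x - y)⟫) := by
    intro w
    rw [Real.cos_sq, real_inner_smul_right, inner_sub_right]
    have : 2 * ((⟪w, x⟫ - ⟪w, y⟫) / (2 * ℓ)) = ℓ⁻¹ * (⟪w, x⟫ - ⟪w, y⟫) := by
      field_simp
    rw [this]
    ring
  simp_rw [hcos]
  have hint : Integrable (fun w => Real.cos ⟪w, ℓ⁻¹ • (x - y)⟫) (stdGaussian D) :=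
    Integrable.of_bound (by fun_prop) 1 (by simp [Real.abs_cos_le_one])
  rw [integral_const_mul, integral_add (integrable_const 1) hint,
    integral_cos_inner_stdGaussian, norm_smul, Real.norm_of_nonneg (by positivity)]
  simp only [integral_const, probReal_univ, smul_eq_mul, mul_one]
  congr 3
  field_simp
end

section
/- Let x, y ∈ ℝ and σ₁, σ₂, ℓ₁, ℓ₂ > 0 with sin((x - y)/(2ℓ₁)) ≠ 0, and let (h_i, h_j) be a centered bivariate Gaussian vector on ℝ² with covariance matrix [[σ₁², σ₁² cos²((x-y)/(2ℓ₁))], [σ₁² cos²((x-y)/(2ℓ₁)), σ₁²]] (which is positive definite under the stated hypothesis). Then E[σ₂² cos²((h_i - h_j)/(2ℓ₂))] = (σ₂²/2) (1 + exp(-(σ₁²/ℓ₂²) sin²((x - y)/(2ℓ₁)))). (SC[SC] equals the periodic kernel of MacKay.) -/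
open MeasureTheory Matrix

open ProbabilityTheory hiding multivariateGaussian

/-- The volume on `ℝ²` is invariant under passing from half-sum and difference to the coordinates. -/
lemma integral_fin_two_eq_integral_halfSum_diff {F : (Fin 2 → ℝ) → ℝ} (hF : Continuous F) :
    ∫ h, F h = ∫ p : ℝ × ℝ, F ![p.2 + p.1 / 2, p.2 - p.1 / 2] := by
  let M : Matrix (Fin 2) (Fin 2) ℝ := !![1 / 2, 1; -1 / 2, 1]
  have hdet : M.det = 1 := by norm_num [M, Matrix.det_fin_two]
  have hM : (volume : Measure (Fin 2 → ℝ)).map (Matrix.toLin' M) = volume := by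
    rw [Real.map_matrix_volume_pi_eq_smul_volume_pi (by simp [hdet]), hdet]
    simp
  have hcont : Continuous (Matrix.toLin' M) := LinearMap.continuous_of_finiteDimensional _
  calc ∫ h, F h = ∫ h, F (Matrix.toLin' M h) := by
        conv_lhs => rw [← hM]
        exact integral_map hcont.aemeasurable hF.aestronglyMeasurable
    _ = ∫ p : ℝ × ℝ, F (Matrix.toLin' M (MeasurableEquiv.finTwoArrow.symm p)) :=
        ((volume_preserving_finTwoArrow ℝ).symm.integral_comp' _).symm
    _ = ∫ p : ℝ × ℝ, F ![p.2 + p.1 / 2, p.2 - p.1 / 2] := by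
        congr 1 with p
        congr 1
        ext i
        fin_cases i <;>
          simp [M, Matrix.mulVec, dotProduct, Fin.sum_univ_two, MeasurableEquiv.finTwoArrow] <;>
          ring

/-- For a centered bivariate Gaussian vector with common variance `a` and correlation `c`, the
difference of the coordinates is a centered Gaussian of variance `2 * a * (1 - c)`. -/
lemma integral_sub_multivariateGaussian {a c : ℝ} (ha : 0 < a) (hc : -1 < c) (hc' : c < 1)
    {f : ℝ → ℝ} (hf : Continuous f) :
    ∫ h, f (h 0 - h 1) ∂(multivariateGaussian 0 !![a, a * c; a * c, a]) =
      ∫ w, f w ∂(gaussianReal 0 (2 * a * (1 - c)).toNNReal) := by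
  have hp : 0 < 1 + c := by linarith
  have hm : 0 < 1 - c := by linarith
  have hv₁ : 0 < 2 * a * (1 - c) := by positivity
  have hv₂ : 0 < a * (1 + c) / 2 := by positivity
  have hv₁' : (2 * a * (1 - c)).toNNReal ≠ 0 := by simpa using hv₁
  have hv₂' : (a * (1 + c) / 2).toNNReal ≠ 0 := by simpa using hv₂
  have hinv : (!![a, a * c; a * c, a] : Matrix (Fin 2) (Fin 2) ℝ)⁻¹ =
      (a * (1 + c) * (1 - c))⁻¹ • !![1, -c; -c, 1] := by
    refine Matrix.inv_eq_left_inv ?_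
    ext i j
    fin_cases i <;> fin_cases j <;>
      simp [Matrix.mul_apply, Fin.sum_univ_two] <;> field_simp <;> ring
  have hdensity (p : ℝ × ℝ) :
      Real.exp (-(1/2) * ((![p.2 + p.1 / 2, p.2 - p.1 / 2] - 0) ⬝ᵥ
        ((!![a, a * c; a * c, a] : Matrix (Fin 2) (Fin 2) ℝ)⁻¹ *ᵥ
          (![p.2 + p.1 / 2, p.2 - p.1 / 2] - 0)))) /
        Real.sqrt ((2 * Real.pi) ^ 2 * (!![a, a * c; a * c, a] : Matrix (Fin 2) (Fin 2) ℝ).det) =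
      gaussianPDFReal 0 (2 * a * (1 - c)).toNNReal p.1 *
        gaussianPDFReal 0 (a * (1 + c) / 2).toNNReal p.2 := by
    have hdet : (2 * Real.pi) ^ 2 * (!![a, a * c; a * c, a] : Matrix (Fin 2) (Fin 2) ℝ).det =
        (2 * Real.pi * (2 * a * (1 - c))) * (2 * Real.pi * (a * (1 + c) / 2)) := by
      rw [Matrix.det_fin_two_of]
      ring
    rw [hdet, Real.sqrt_mul (by positivity), hinv, gaussianPDFReal, gaussianPDFReal,
      Real.coe_toNNReal _ hv₁.le, Real.coe_toNNReal _ hv₂.le,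
      mul_mul_mul_comm _ (Real.exp _), ← Real.exp_add,
      ← mul_inv, div_eq_inv_mul]
    congr 2
    simp [Matrix.mulVec, dotProduct, Fin.sum_univ_two]
    field_simp
    ring
  rw [multivariateGaussian, integral_withDensity_eq_integral_toReal_smul
    (by fun_prop) (by simp)]
  simp_rw [ENNReal.toReal_ofReal (div_nonneg (Real.exp_nonneg _) (Real.sqrt_nonneg _))]
  rw [integral_fin_two_eq_integral_halfSum_diff (by fun_prop)]
  simp_rw [hdensity]
  calc _ = ∫ p : ℝ × ℝ, (gaussianPDFReal 0 (2 * a * (1 - c)).toNNReal p.1 * f p.1) *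
          gaussianPDFReal 0 (a * (1 + c) / 2).toNNReal p.2 := by
        congr 1 with p
        have : p.2 + p.1 / 2 - (p.2 - p.1 / 2) = p.1 := by ring
        simp [this]
        ring
    _ = _ := by
        rw [Measure.volume_eq_prod,
          integral_prod_mul (fun w ↦ gaussianPDFReal 0 (2 * a * (1 - c)).toNNReal w * f w),
          integral_gaussianPDFReal_eq_one 0 hv₂', mul_one,
          integral_gaussianReal_eq_integral_smul hv₁']
        simp

lemma integral_cos_gaussianReal (v : NNReal) (t : ℝ) :
    ∫ w, Real.cos (t * w) ∂(gaussianReal 0 v) = Real.exp (-(v * t ^ 2 / 2)) := by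
  have hint : Integrable (fun w : ℝ ↦ Complex.exp (t * w * Complex.I)) (gaussianReal 0 v) :=
    Integrable.of_bound (by fun_prop) 1 (ae_of_all _ fun w ↦ by
      rw [← Complex.ofReal_mul, Complex.norm_exp_ofReal_mul_I])
  have h := charFun_gaussianReal (μ := 0) (v := v) t
  rw [charFun_apply_real] at h
  have hre := congrArg Complex.re h
  rw [← RCLike.re_eq_complex_re, ← integral_re hint] at hre
  calc ∫ w, Real.cos (t * w) ∂(gaussianReal 0 v) =
        ∫ w : ℝ, RCLike.re (Complex.exp (t * w * Complex.I)) ∂(gaussianReal 0 v) := by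
        congr 1 with w
        rw [← Complex.ofReal_mul, RCLike.re_eq_complex_re, Complex.exp_ofReal_mul_I_re]
    _ = _ := by
        rw [hre, RCLike.re_eq_complex_re, ← Complex.exp_ofReal_re]
        congr 2
        push_cast
        ring

/-- SC[SC] equals the periodic kernel of MacKay. -/
theorem effective_kernel_SCSC (x y σ₁ σ₂ ℓ₁ ℓ₂ : ℝ)
    (hσ₁ : 0 < σ₁) (hσ₂ : 0 < σ₂) (hℓ₁ : 0 < ℓ₁) (hℓ₂ : 0 < ℓ₂)
    (hs : Real.sin ((x - y) / (2 * ℓ₁)) ≠ 0) :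
    (∫ h, σ₂^2 * Real.cos ((h 0 - h 1) / (2 * ℓ₂))^2
        ∂(multivariateGaussian 0
          !![σ₁^2, σ₁^2 * Real.cos ((x - y) / (2 * ℓ₁))^2;
             σ₁^2 * Real.cos ((x - y) / (2 * ℓ₁))^2, σ₁^2])) =
      (σ₂^2 / 2) * (1 + Real.exp (-(σ₁^2 / ℓ₂^2) * Real.sin ((x - y) / (2 * ℓ₁))^2)) := by
  set s := Real.sin ((x - y) / (2 * ℓ₁))
  have hcos : Real.cos ((x - y) / (2 * ℓ₁)) ^ 2 = 1 - s ^ 2 := Real.cos_sq' _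
  have hs2 : 0 < s ^ 2 := by positivity
  have hs2' : s ^ 2 ≤ 1 := Real.sin_sq_le_one _
  have hσ₁2 : 0 < σ₁ ^ 2 := by positivity
  rw [hcos, integral_sub_multivariateGaussian (f := fun w ↦ σ₂ ^ 2 * Real.cos (w / (2 * ℓ₂)) ^ 2)
    hσ₁2 (by linarith) (by linarith) (by fun_prop)]
  have hhalf (w : ℝ) : σ₂ ^ 2 * Real.cos (w / (2 * ℓ₂)) ^ 2 =
      σ₂ ^ 2 / 2 * (1 + Real.cos (ℓ₂⁻¹ * w)) := by
    rw [Real.cos_sq, show 2 * (w / (2 * ℓ₂)) = ℓ₂⁻¹ * w by field_simp]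
    ring
  simp_rw [hhalf]
  have hint (v : NNReal) : Integrable (fun w ↦ Real.cos (ℓ₂⁻¹ * w)) (gaussianReal 0 v) :=
    Integrable.of_bound (by fun_prop) 1 (ae_of_all _ fun w ↦ Real.abs_cos_le_one _)
  rw [integral_const_mul, integral_add (integrable_const _) (hint _), integral_cos_gaussianReal,
    Real.coe_toNNReal _ (by nlinarith)]
  simp only [integral_const, probReal_univ, smul_eq_mul, mul_one]
  congr 3
  field_simp
  ring
end

section
/- Let σ₁, σ₂, ℓ₁, ℓ₂ > 0 and define the effective SE[SE] kernel k_eff(Δ) = σ₂² (1 + (2σ₁²/ℓ₂²)(1 - exp(-Δ²/(2ℓ₁²))))^{-1/2} for Δ ∈ ℝ. Then the function Δ ↦ 2(σ₂² - k_eff(Δ))/Δ² tends to σ₂² σ₁²/(ℓ₂² ℓ₁²) as Δ → 0 with Δ ≠ 0. Equivalently, the expected squared derivative of a function sampled from the effective SE[SE] GP satisfies E[(f'(x))²]/σ₂² = σ₁²/(ℓ₂² ℓ₁²) = χ/ℓ₁², where χ = σ₁²/ℓ₂² is the expressivity parameter. -/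
open Filter

/-- If `g` has derivative `g'` at `0`, then `(g (x ^ 2) - g 0) / x ^ 2` tends to `g'` as `x → 0`,
`x ≠ 0`. -/
theorem HasDerivAt.tendsto_div_sq {g : ℝ → ℝ} {g' : ℝ} (h : HasDerivAt g g' 0) :
    Tendsto (fun x : ℝ => (g (x ^ 2) - g 0) / x ^ 2) (nhdsWithin 0 {0}ᶜ) (nhds g') := by
  have hsq : Tendsto (fun x : ℝ => x ^ 2) (nhdsWithin 0 {0}ᶜ) (nhdsWithin 0 {0}ᶜ) := by
    refine tendsto_nhdsWithin_iff.2 ⟨?_, ?_⟩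
    · have hc : Continuous fun x : ℝ => x ^ 2 := by fun_prop
      exact (hc.tendsto' 0 0 (by simp)).mono_left nhdsWithin_le_nhds
    · filter_upwards [self_mem_nhdsWithin] with x hx
      exact pow_ne_zero 2 hx
  refine (h.tendsto_slope.comp hsq).congr fun x => ?_
  simp [slope_def_field]

/-- The derivative at `0` of the normalised effective SE[SE] kernel as a function of the squared
separation. -/
theorem hasDerivAt_one_add_mul_one_sub_exp_rpow (c a : ℝ) :
    HasDerivAt (fun t : ℝ => (1 + c * (1 - Real.exp (-t / a))) ^ (-(1 : ℝ) / 2))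
      (-(c / (2 * a))) 0 := by
  have h : HasDerivAt (fun t : ℝ => 1 + c * (1 - Real.exp (-t / a))) (c / a) 0 := by
    have := (((((hasDerivAt_id (0 : ℝ)).neg.div_const a).exp).const_sub 1).const_mul c).const_add 1
    refine this.congr_deriv ?_
    simp
    ring
  convert h.rpow_const (p := -(1 : ℝ) / 2) (by simp) using 1
  simp
  ring

/-- The expected squared derivative of a function sampled from the effective SE[SE] GP:
2(σ₂² - k_eff(Δ))/Δ² tends to σ₂²σ₁²/(ℓ₂²ℓ₁²) = σ₂²·χ/ℓ₁² as Δ → 0, Δ ≠ 0. -/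
theorem SESE_expected_squared_derivative (σ₁ σ₂ ℓ₁ ℓ₂ : ℝ)
    (hσ₁ : 0 < σ₁) (hσ₂ : 0 < σ₂) (hℓ₁ : 0 < ℓ₁) (hℓ₂ : 0 < ℓ₂) :
    Tendsto
      (fun Δ : ℝ =>
        2 * (σ₂^2 -
          σ₂^2 * (1 + (2 * σ₁^2 / ℓ₂^2) * (1 - Real.exp (-Δ^2 / (2 * ℓ₁^2)))) ^ (-(1:ℝ)/2))
          / Δ^2)
      (nhdsWithin 0 {0}ᶜ) (nhds (σ₂^2 * σ₁^2 / (ℓ₂^2 * ℓ₁^2))) := by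
  have h := (hasDerivAt_one_add_mul_one_sub_exp_rpow
    (2 * σ₁ ^ 2 / ℓ₂ ^ 2) (2 * ℓ₁ ^ 2)).tendsto_div_sq.const_mul (-2 * σ₂ ^ 2)
  convert h using 2
  · simp only [neg_zero, zero_div, Real.exp_zero, sub_self, mul_zero, add_zero, Real.one_rpow]
    ring
  · field_simp
end

section
/- Let n ≥ 1, let K be a positive semidefinite n×n real matrix, and let σ > 0, ℓ > 0. Then the n×n matrix M with entries M_{ij} = σ² (1 + (K_{ii} + K_{jj} - 2 K_{ij})/ℓ²)^{-1/2} is positive semidefinite. (The effective SE[SE]-type covariance matrix obtained as the exact second moment of a two-layer DGP is a valid covariance matrix.) -/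
open Matrix

namespace Matrix

variable {ι : Type*} [Fintype ι]

theorem posSemidef_real_iff_sum {M : Matrix ι ι ℝ} :
    M.PosSemidef ↔ (∀ i j, M i j = M j i) ∧ ∀ x : ι → ℝ, 0 ≤ ∑ i, ∑ j, x i * (M i j * x j) := by
  simp only [posSemidef_iff_dotProduct_mulVec, dotProduct, mulVec, Finset.mul_sum,
    Pi.star_apply, star_trivial, IsHermitian.ext_iff]
  exact and_congr_left fun _ => forall_comm

theorem PosSemidef.of_hasSum {κ : Type*} {A : κ → Matrix ι ι ℝ} {M : Matrix ι ι ℝ}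
    (hA : ∀ k, (A k).PosSemidef) (h : ∀ i j, HasSum (fun k => A k i j) (M i j)) :
    M.PosSemidef := by
  simp only [posSemidef_real_iff_sum] at hA ⊢
  refine ⟨fun i j => (h i j).unique ?_, fun x => ?_⟩
  · simpa only [fun k => (hA k).1 i j] using h j i
  · exact (hasSum_sum fun i _ => hasSum_sum fun j _ =>
      ((h i j).mul_right (x j)).mul_left (x i)).nonneg fun k => (hA k).2 x

open MeasureTheory in
theorem PosSemidef.integral {Ω : Type*} [MeasurableSpace Ω] {μ : Measure Ω}
    {A : Ω → Matrix ι ι ℝ} (hA : ∀ ω, (A ω).PosSemidef)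
    (hint : ∀ i j, Integrable (fun ω => A ω i j) μ) :
    (Matrix.of fun i j => ∫ ω, A ω i j ∂μ).PosSemidef := by
  simp only [posSemidef_real_iff_sum, of_apply] at hA ⊢
  refine ⟨fun i j => by simp only [fun ω => (hA ω).1 i j], fun x => ?_⟩
  have hterm : ∀ i j, Integrable (fun ω => x i * (A ω i j * x j)) μ := fun i j =>
    ((hint i j).mul_const (x j)).const_mul (x i)
  have hsum : ∑ i, ∑ j, x i * ((∫ ω, A ω i j ∂μ) * x j) =
      ∫ ω, ∑ i, ∑ j, x i * (A ω i j * x j) ∂μ := by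
    rw [integral_finsetSum _ fun i _ => integrable_finsetSum _ fun j _ => hterm i j]
    refine Finset.sum_congr rfl fun i _ => ?_
    rw [integral_finsetSum _ fun j _ => hterm i j]
    simp only [integral_const_mul, integral_mul_const]
  rw [hsum]
  exact integral_nonneg fun ω => (hA ω).2 x

theorem posSemidef_of_mul_self (d : ι → ℝ) : (Matrix.of fun i j => d i * d j).PosSemidef := by
  simpa [vecMulVec] using posSemidef_vecMulVec_self_star d

theorem PosSemidef.map_pow {A : Matrix ι ι ℝ} (hA : A.PosSemidef) (k : ℕ) :
    (A.map (· ^ k)).PosSemidef := by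
  induction k with
  | zero => simpa [Matrix.map] using posSemidef_of_mul_self fun _ : ι => (1 : ℝ)
  | succ k ih =>
    simp only [pow_succ]
    exact ih.hadamard hA

theorem PosSemidef.map_exp {A : Matrix ι ι ℝ} (hA : A.PosSemidef) :
    (A.map Real.exp).PosSemidef := by
  refine PosSemidef.of_hasSum (A := fun k : ℕ => ((k.factorial : ℝ)⁻¹) • A.map (· ^ k))
    (fun k => (hA.map_pow k).smul (by positivity)) fun i j => ?_
  simpa [div_eq_inv_mul, Real.exp_eq_exp_ℝ] using NormedSpace.expSeries_div_hasSum_exp (A i j)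

/-- The squared exponential kernel of the semi-metric induced by `K` is positive semidefinite. -/
theorem PosSemidef.exp_neg_dist {K : Matrix ι ι ℝ} (hK : K.PosSemidef) {t : ℝ} (ht : 0 ≤ t) :
    (Matrix.of fun i j => Real.exp (-t * (K i i + K j j - 2 * K i j))).PosSemidef := by
  convert! (posSemidef_of_mul_self fun i => Real.exp (-t * K i i)).hadamard
    (hK.smul (mul_nonneg zero_le_two ht)).map_exp using 1
  ext i j
  simp only [of_apply, hadamard_apply, map_apply, smul_apply, smul_eq_mul, ← Real.exp_add]
  ring_nf

theorem PosSemidef.dist_nonneg {K : Matrix ι ι ℝ} (hK : K.PosSemidef) (i j : ι) :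
    0 ≤ K i i + K j j - 2 * K i j := by
  classical
  have h := (posSemidef_iff_dotProduct_mulVec.1 hK).2 (Pi.single i 1 - Pi.single j 1)
  have hsymm := (posSemidef_real_iff_sum.1 hK).1 i j
  simp [mulVec_sub, sub_dotProduct] at h
  linarith

end Matrix

theorem Real.rpow_neg_half_eq_integral {b : ℝ} (hb : 0 < b) :
    b ^ (-(1 : ℝ) / 2) = (√Real.pi)⁻¹ * ∫ x : ℝ, Real.exp (-b * x ^ 2) := by
  rw [integral_gaussian, Real.sqrt_div Real.pi_pos.le, neg_div, Real.rpow_neg hb.le,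
    ← Real.sqrt_eq_rpow]
  have := Real.sqrt_pos.2 Real.pi_pos
  field_simp

/-- The effective SE[SE]-type covariance matrix obtained as the exact second moment of a
two-layer DGP is a valid (positive semidefinite) covariance matrix. -/
theorem effective_kernel_posSemidef (n : ℕ) (hn : 1 ≤ n)
    (K : Matrix (Fin n) (Fin n) ℝ) (hK : K.PosSemidef) (σ ℓ : ℝ) (hσ : 0 < σ) (hℓ : 0 < ℓ) :
    (Matrix.of fun i j : Fin n =>
      σ^2 * (1 + (K i i + K j j - 2 * K i j) / ℓ^2) ^ (-(1:ℝ)/2)).PosSemidef := by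
  have hpos : ∀ i j, 0 < 1 + (K i i + K j j - 2 * K i j) / ℓ ^ 2 := fun i j =>
    add_pos_of_pos_of_nonneg one_pos (div_nonneg (hK.dist_nonneg i j) (sq_nonneg ℓ))
  have hslice : ∀ x : ℝ, (Matrix.of fun i j : Fin n =>
      Real.exp (-(1 + (K i i + K j j - 2 * K i j) / ℓ ^ 2) * x ^ 2)).PosSemidef := fun x => by
    convert! (hK.exp_neg_dist (t := x ^ 2 / ℓ ^ 2) (by positivity)).smul
      (Real.exp_pos (-x ^ 2)).le using 1
    ext i j
    simp only [of_apply, Matrix.smul_apply, smul_eq_mul, ← Real.exp_add]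
    ring_nf
  convert! (PosSemidef.integral (μ := MeasureTheory.volume) hslice fun i j =>
    integrable_exp_neg_mul_sq (hpos i j)).smul
      (show 0 ≤ σ ^ 2 * (√Real.pi)⁻¹ by positivity) using 1
  ext i j
  simp only [of_apply, Matrix.smul_apply, smul_eq_mul]
  rw [Real.rpow_neg_half_eq_integral (hpos i j), mul_assoc]
end

section
/- Let (h_i, h_j) be a centered bivariate Gaussian vector on ℝ² with positive definite covariance matrix, and let σ₂, σ₃, ℓ₂, ℓ₃ > 0. For h = (h_i, h_j) with h_i ≠ h_j, let c(h) = exp(-(h_i - h_j)²/(2ℓ₂²)) and let K₂(h) be the (positive definite) 2×2 matrix [[σ₂², σ₂² c(h)], [σ₂² c(h), σ₂²]]. Then the iterated expectation E_h[ E_{g ~ N(0, K₂(h))}[ σ₃² exp(-(g_i - g_j)²/(2ℓ₃²)) ] ] equals E_h[ σ₃² (1 + (2σ₂²/ℓ₃²)(1 - c(h)))^{-1/2} ]. (The second moment of the three-layer DGP SE[SE[·]], Eq. (33) of the paper.) -/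
open MeasureTheory Matrix

/-- The value of a two-dimensional Gaussian integral with exponent
`-(a x² + a y² - 2 b x y)`. -/
theorem integral_exp_neg_quadraticForm (a b : ℝ) (hb : 0 ≤ b) (hab : b < a) :
    ∫ p : ℝ × ℝ, Real.exp (-(a * p.1 ^ 2 + a * p.2 ^ 2 - 2 * b * p.1 * p.2)) =
      Real.pi / Real.sqrt (a ^ 2 - b ^ 2) := by
  have ha : 0 < a := hb.trans_lt hab
  have hd : 0 < a - b := sub_pos.mpr hab
  have hD : 0 < a ^ 2 - b ^ 2 := by nlinarith
  have hint : Integrable (fun p : ℝ × ℝ =>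
      Real.exp (-(a * p.1 ^ 2 + a * p.2 ^ 2 - 2 * b * p.1 * p.2))) (volume.prod volume) := by
    have h1 := integrable_exp_neg_mul_sq hd
    refine (h1.mul_prod h1).mono' (by fun_prop) (ae_of_all _ fun p => ?_)
    rw [Real.norm_of_nonneg (Real.exp_pos _).le, ← Real.exp_add]
    apply Real.exp_le_exp.mpr
    nlinarith [mul_nonneg hb (sq_nonneg (p.1 - p.2))]
  have hinner : ∀ y : ℝ,
      ∫ x : ℝ, Real.exp (-(a * x ^ 2 + a * y ^ 2 - 2 * b * x * y)) =
        Real.sqrt (Real.pi / a) * Real.exp (-((a ^ 2 - b ^ 2) / a) * y ^ 2) := by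
    intro y
    have hsq : ∀ x : ℝ, Real.exp (-(a * x ^ 2 + a * y ^ 2 - 2 * b * x * y)) =
        Real.exp (-a * (x - b / a * y) ^ 2) * Real.exp (-((a ^ 2 - b ^ 2) / a) * y ^ 2) := by
      intro x
      rw [← Real.exp_add]
      congr 1
      field_simp
      ring
    simp_rw [hsq]
    rw [integral_mul_const, integral_sub_right_eq_self (fun x => Real.exp (-a * x ^ 2)),
      integral_gaussian]
  rw [Measure.volume_eq_prod, integral_prod_symm _ hint]
  simp only [hinner]
  rw [integral_const_mul, integral_gaussian, ← Real.sqrt_mul (by positivity),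
    show Real.pi / a * (Real.pi / ((a ^ 2 - b ^ 2) / a)) = Real.pi ^ 2 / (a ^ 2 - b ^ 2) by
      field_simp,
    Real.sqrt_div (by positivity), Real.sqrt_sq Real.pi_pos.le]

/-- Closed form of the expectation of a squared exponential kernel under a centered bivariate
Gaussian with equal variances `s` and correlation `c`. -/
theorem integral_exp_neg_sq_sub_multivariateGaussian (s c L : ℝ) (hs : 0 < s) (hc : 0 ≤ c)
    (hc1 : c < 1) (hL : 0 < L) :
    ∫ g, Real.exp (-(g 0 - g 1) ^ 2 / (2 * L)) ∂(multivariateGaussian 0 !![s, s * c; s * c, s]) =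
      (1 + (2 * s / L) * (1 - c)) ^ (-(1 : ℝ) / 2) := by
  have h1c : 0 < 1 - c := sub_pos.mpr hc1
  have h1c' : 0 < 1 + c := by linarith
  have hdet : (!![s, s * c; s * c, s] : Matrix (Fin 2) (Fin 2) ℝ).det =
      s ^ 2 * ((1 - c) * (1 + c)) := by
    rw [Matrix.det_fin_two_of]
    ring
  have hquad : ∀ x : Fin 2 → ℝ,
      x ⬝ᵥ ((!![s, s * c; s * c, s] : Matrix (Fin 2) (Fin 2) ℝ)⁻¹ *ᵥ x) =
        (x 0 ^ 2 + x 1 ^ 2 - 2 * c * x 0 * x 1) / (s * ((1 - c) * (1 + c))) := by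
    intro x
    rw [Matrix.inv_def, hdet, Matrix.adjugate_fin_two_of, Ring.inverse_eq_inv']
    simp [Matrix.mulVec, dotProduct, Fin.sum_univ_two]
    field_simp
    ring
  set a : ℝ := 1 / (2 * s * ((1 - c) * (1 + c))) + 1 / (2 * L) with ha
  set b : ℝ := c / (2 * s * ((1 - c) * (1 + c))) + 1 / (2 * L) with hb
  have hb0 : 0 ≤ b := by positivity
  have hab : b < a := by
    rw [ha, hb]
    gcongr
  set R : ℝ := 1 + (2 * s / L) * (1 - c) with hR
  have hR0 : 0 < R := by positivity
  have hdisc : a ^ 2 - b ^ 2 = R / (4 * (s ^ 2 * ((1 - c) * (1 + c)))) := by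
    rw [ha, hb, hR]
    field_simp
    ring
  unfold multivariateGaussian
  rw [integral_withDensity_eq_integral_toReal_smul (by unfold Matrix.mulVec dotProduct; fun_prop)
    (ae_of_all _ fun _ => ENNReal.ofReal_lt_top)]
  have hintegrand : ∀ x : Fin 2 → ℝ,
      (ENNReal.ofReal (Real.exp (-(1/2) * ((x - 0) ⬝ᵥ
        ((!![s, s * c; s * c, s] : Matrix (Fin 2) (Fin 2) ℝ)⁻¹ *ᵥ (x - 0)))) /
        Real.sqrt ((2 * Real.pi) ^ 2 *
          (!![s, s * c; s * c, s] : Matrix (Fin 2) (Fin 2) ℝ).det))).toReal •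
        Real.exp (-(x 0 - x 1) ^ 2 / (2 * L)) =
      (Real.sqrt ((2 * Real.pi) ^ 2 * (s ^ 2 * ((1 - c) * (1 + c)))))⁻¹ *
        Real.exp (-(a * x 0 ^ 2 + a * x 1 ^ 2 - 2 * b * x 0 * x 1)) := by
    intro x
    rw [ENNReal.toReal_ofReal (by positivity), sub_zero, hquad, hdet, smul_eq_mul, div_eq_inv_mul,
      mul_assoc, ← Real.exp_add]
    congr 2
    rw [ha, hb]
    field_simp
    ring
  simp_rw [hintegrand]
  rw [integral_const_mul]
  have hmp := (volume_preserving_finTwoArrow ℝ).integral_comp'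
    (fun p : ℝ × ℝ => Real.exp (-(a * p.1 ^ 2 + a * p.2 ^ 2 - 2 * b * p.1 * p.2)))
  simp only [MeasurableEquiv.finTwoArrow_apply] at hmp
  rw [hmp, integral_exp_neg_quadraticForm a b hb0 hab, hdisc]
  have hT0 : 0 < s ^ 2 * ((1 - c) * (1 + c)) := by positivity
  generalize s ^ 2 * ((1 - c) * (1 + c)) = T at hT0 ⊢
  rw [Real.sqrt_mul (by positivity), Real.sqrt_sq (by positivity), Real.sqrt_div hR0.le,
    show (4 : ℝ) = 2 ^ 2 by norm_num, Real.sqrt_mul (by positivity), Real.sqrt_sq (by norm_num),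
    show (-(1 : ℝ) / 2) = -(1 / 2) by ring, Real.rpow_neg hR0.le, ← Real.sqrt_eq_rpow]
  have := Real.sqrt_pos.mpr hT0
  have := Real.sqrt_pos.mpr hR0
  field_simp

/-- The two coordinates of a Gaussian vector given by a density are almost surely distinct. -/
theorem ae_ne_multivariateGaussian (v : Fin 2 → ℝ) (K : Matrix (Fin 2) (Fin 2) ℝ) :
    ∀ᵐ h ∂(multivariateGaussian v K), h 0 ≠ h 1 := by
  refine (withDensity_absolutelyContinuous _ _).ae_le ?_
  have hnull := Measure.addHaar_submodule (volume : Measure (Fin 2 → ℝ))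
    (LinearMap.ker ((LinearMap.proj 0 : (Fin 2 → ℝ) →ₗ[ℝ] ℝ) - LinearMap.proj 1)) (by
      intro htop
      have hmem : (![1, 0] : Fin 2 → ℝ) ∈
          LinearMap.ker ((LinearMap.proj 0 : (Fin 2 → ℝ) →ₗ[ℝ] ℝ) - LinearMap.proj 1) :=
        htop ▸ Submodule.mem_top
      simp at hmem)
  refine measure_mono_null (fun h hh => ?_) hnull
  simpa [sub_eq_zero] using hh

/-- The second moment of the three-layer DGP SE[SE[·]], Eq. (33): the inner Gaussian
expectation over the middle layer can be evaluated in closed form. -/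
theorem second_moment_three_layer (K : Matrix (Fin 2) (Fin 2) ℝ) (hK : K.PosDef)
    (σ₂ σ₃ ℓ₂ ℓ₃ : ℝ) (hσ₂ : 0 < σ₂) (hσ₃ : 0 < σ₃) (hℓ₂ : 0 < ℓ₂) (hℓ₃ : 0 < ℓ₃) :
    (∫ h, (∫ g, σ₃^2 * Real.exp (-(g 0 - g 1)^2 / (2 * ℓ₃^2))
        ∂(multivariateGaussian 0
          !![σ₂^2, σ₂^2 * Real.exp (-(h 0 - h 1)^2 / (2 * ℓ₂^2));
             σ₂^2 * Real.exp (-(h 0 - h 1)^2 / (2 * ℓ₂^2)), σ₂^2]))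
      ∂(multivariateGaussian 0 K)) =
    (∫ h, σ₃^2 * (1 + (2 * σ₂^2 / ℓ₃^2) * (1 - Real.exp (-(h 0 - h 1)^2 / (2 * ℓ₂^2))))
        ^ (-(1:ℝ)/2)
      ∂(multivariateGaussian 0 K)) := by
  refine integral_congr_ae ?_
  filter_upwards [ae_ne_multivariateGaussian 0 K] with h hne
  have hpos : 0 < (h 0 - h 1) ^ 2 := by
    have := sub_ne_zero.mpr hne
    positivity
  rw [integral_const_mul, integral_exp_neg_sq_sub_multivariateGaussian (σ₂ ^ 2) _ (ℓ₃ ^ 2)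
    (by positivity) (Real.exp_pos _).le _ (by positivity)]
  rw [Real.exp_lt_one_iff, neg_div]
  exact neg_neg_of_pos (by positivity)
end
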